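/- arXiv:1511.01687 — 6 statements merged into one kernel-verified Lean document; each statement's English description precedes it below -/
import Mathlib

section
/- Let d ≥ 2 and ε ∈ (0,1). Let λ : [0,∞) → ℝ be continuous and let φ : ℝ^d × [0,∞) → ℝ be a smooth ℤ^d-periodic (in x) solution of ε∂_tφ = εΔφ − W'(φ)/ε + λ(t)√(2W(φ)) with |φ(x,t)| < 1 for all (x,t), whose initial datum has the form φ(x,0) = tanh(r₀(x)/ε) for a smooth ℤ^d-periodic function r₀ with |∇r₀(x)| ≤ 1 for all x. Then the discrepancy is non-positive: ε|∇φ(x,t)|²/2 − W(φ(x,t))/ε ≤ 0 for every (x,t) ∈ ℝ^d × [0,∞). -/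
open MeasureTheory Real Set

noncomputable section

/-- Euclidean space ℝ^d. -/
abbrev Ed (d : ℕ) := EuclideanSpace ℝ (Fin d)

/-- The double-well potential W(s) = (1-s²)²/2. -/
def W (s : ℝ) : ℝ := (1 - s ^ 2) ^ 2 / 2

/-- Its derivative W'(s) = 2s³ - 2s. -/
def W' (s : ℝ) : ℝ := 2 * s ^ 3 - 2 * s

/-- Standard basis vector of ℝ^d. -/
def ebasis (d : ℕ) (i : Fin d) : Ed d := EuclideanSpace.single i 1

/-- The Laplacian, as the sum of second partial derivatives. -/
def lap {d : ℕ} (f : Ed d → ℝ) (x : Ed d) : ℝ :=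
  ∑ i, fderiv ℝ (fun y => fderiv ℝ f y (ebasis d i)) x (ebasis d i)

/-- ℤ^d-periodicity. -/
def ZdPeriodic {d : ℕ} {α : Type*} (f : Ed d → α) : Prop :=
  ∀ (x : Ed d) (k : Fin d → ℤ), f (x + (WithLp.equiv 2 (Fin d → ℝ)).symm fun i => (k i : ℝ)) = f x

/-- the inverse hyperbolic tangent -/
def gg (s : ℝ) : ℝ := (Real.log (1 + s) - Real.log (1 - s)) / 2

lemma gg_deriv {s : ℝ} (hs : |s| < 1) : HasDerivAt gg (1 / (1 - s ^ 2)) s := by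
  obtain ⟨h1, h2⟩ := abs_lt.1 hs
  have a : HasDerivAt (fun x : ℝ => 1 + x) 1 s := (hasDerivAt_id s).const_add 1
  have b : HasDerivAt (fun x : ℝ => 1 - x) (-1) s := (hasDerivAt_id s).const_sub 1
  have n1 : 1 + s ≠ 0 := by linarith
  have n2 : 1 - s ≠ 0 := by linarith
  have h := ((a.log n1).sub (b.log n2)).div_const 2
  refine h.congr_deriv ?_
  have n3 : 1 - s ^ 2 ≠ 0 := by
    rw [show 1 - s ^ 2 = (1 + s) * (1 - s) by ring]; exact mul_ne_zero n1 n2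
  rw [show 1 - s ^ 2 = (1 + s) * (1 - s) by ring]
  field_simp
  ring

lemma gg_tanh (r : ℝ) : gg (Real.tanh r) = r := by
  have h1 := Real.neg_one_lt_tanh r
  have h2 := Real.tanh_lt_one r
  have := Real.artanh_eq_half_log (x := Real.tanh r) ⟨h1.le, h2.le⟩
  rw [Real.artanh_tanh, Real.log_div (by linarith) (by linarith)] at this
  unfold gg
  linarith

lemma one_sub_sq_pos {s : ℝ} (hs : |s| < 1) : 0 < 1 - s ^ 2 := by
  have := (sq_lt_one_iff_abs_lt_one s).2 hs
  linarith

/-- second derivative test -/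
lemma second_nonpos {f f1 : ℝ → ℝ} {f2 : ℝ} (hf : ∀ s, HasDerivAt f (f1 s) s)
    (hf1 : HasDerivAt f1 f2 0) (hmax : ∀ s, f s ≤ f 0) : f2 ≤ 0 := by
  by_contra hpos
  push Not at hpos
  have e1 : deriv f = f1 := funext fun s => (hf s).deriv
  have hlm : IsLocalMax f 0 := Filter.Eventually.of_forall hmax
  have hmin : IsLocalMin f 0 := by
    apply isLocalMin_of_deriv_deriv_pos
    · rw [e1, hf1.deriv]; exact hpos
    · exact hlm.deriv_eq_zero
    · exact (hf 0).continuousAt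
  have hc : f =ᶠ[nhds 0] fun _ => f 0 := by
    filter_upwards [hmin] with s hs
    exact le_antisymm (hmax s) hs
  have h2 := hc.deriv
  have h3 := h2.deriv_eq
  rw [e1, hf1.deriv] at h3
  simp at h3
  linarith

lemma comp_second {u u1 : ℝ → ℝ} {u2 : ℝ} (hu : ∀ s, HasDerivAt u (u1 s) s)
    (hu1 : HasDerivAt u1 u2 0) (hb : ∀ s, |u s| < 1) :
    (∀ s, HasDerivAt (fun s => gg (u s)) (u1 s / (1 - u s ^ 2)) s) ∧
    HasDerivAt (fun s => u1 s / (1 - u s ^ 2))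
      (u2 / (1 - u 0 ^ 2) + 2 * u 0 * u1 0 ^ 2 / (1 - u 0 ^ 2) ^ 2) 0 := by
  constructor
  · intro s
    refine ((gg_deriv (hb s)).comp s (hu s)).congr_deriv ?_
    ring
  · have n := (one_sub_sq_pos (hb 0)).ne'
    have := hu1.div (((hu 0).pow 2).const_sub 1) n
    refine this.congr_deriv ?_
    simp only [Pi.pow_apply]
    field_simp
    push_cast
    ring

lemma left_deriv {f : ℝ → ℝ} {f' t : ℝ} (hf : HasDerivAt f f' t) (ht : 0 < t)
    (hmax : ∀ s ∈ Set.Icc 0 t, f s ≤ f t) : 0 ≤ f' := by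
  have h := (hf.tendsto_slope).mono_left (nhdsLT_le_nhdsNE t)
  refine ge_of_tendsto h ?_
  filter_upwards [Ioo_mem_nhdsLT ht] with s hs
  rw [slope_def_field]
  have := hmax s ⟨hs.1.le, hs.2.le⟩
  exact div_nonneg_of_nonpos (by linarith) (by linarith [hs.2])

lemma norm_line {d : ℕ} (a v : Ed d) (ha : a ≠ 0) :
    HasDerivAt (fun s : ℝ => ‖a + s • v‖) (inner ℝ a v / ‖a‖) 0 := by
  have h1 : HasDerivAt (fun s : ℝ => a + s • v) v 0 := by
    simpa using ((hasDerivAt_id (0 : ℝ)).smul_const v).const_add a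
  have h2 := h1.norm_sq.sqrt (by simpa using ha)
  simp only [Real.sqrt_sq (norm_nonneg _), zero_smul, add_zero] at h2
  refine h2.congr_deriv ?_
  have := norm_ne_zero_iff.2 ha
  field_simp

lemma inner_ebasis {d : ℕ} (a : Ed d) (i : Fin d) : inner ℝ a (ebasis d i) = a i := by
  simp [ebasis, EuclideanSpace.inner_single_right]

lemma line_deriv {d : ℕ} {f : Ed d → ℝ} (hf : Differentiable ℝ f) (x v : Ed d) (s : ℝ) :
    HasDerivAt (fun s : ℝ => f (x + s • v)) (fderiv ℝ f (x + s • v) v) s := by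
  have h1 : HasDerivAt (fun s : ℝ => x + s • v) v s := by
    simpa using ((hasDerivAt_id s).smul_const v).const_add x
  exact (hf (x + s • v)).hasFDerivAt.comp_hasDerivAt s h1

lemma smooth_partial {d : ℕ} {f : Ed d → ℝ} (hf : ContDiff ℝ (⊤ : ℕ∞) f) (v : Ed d) :
    Differentiable ℝ (fun y => fderiv ℝ f y v) := by
  have h := hf.fderiv_right (m := 1) (by norm_cast)
  have h2 : ContDiff ℝ 1 (fun y => fderiv ℝ f y v) := h.clm_apply contDiff_const
  exact h2.differentiable (by norm_num)

/-- first-order condition and second-order condition at a doubled maximum -/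
lemma spatial {d : ℕ} {ε : ℝ} (hε : 0 < ε) {f : Ed d → ℝ} (hf : ContDiff ℝ (⊤ : ℕ∞) f)
    (hb : ∀ x, |f x| < 1) (x y : Ed d) (hxy : x ≠ y)
    (hmax : ∀ x' y', ε * gg (f x') - ε * gg (f y') - ‖x' - y'‖
      ≤ ε * gg (f x) - ε * gg (f y) - ‖x - y‖) :
    ε * lap f x / (1 - f x ^ 2) + 2 * f x / ε ≤ ε * lap f y / (1 - f y ^ 2) + 2 * f y / ε := by
  have hfd : Differentiable ℝ f := hf.differentiable (by simp)
  have ha : x - y ≠ 0 := sub_ne_zero.2 hxy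
  have hn : ‖x - y‖ ≠ 0 := norm_ne_zero_iff.2 ha
  have key := fun (z : Ed d) (i : Fin d) =>
    comp_second (u := fun s => f (z + s • ebasis d i))
      (fun s => line_deriv hfd z (ebasis d i) s)
      (line_deriv (smooth_partial hf (ebasis d i)) z (ebasis d i) 0) (fun s => hb _)
  simp only [zero_smul, add_zero] at key
  have gx : ∀ i, ε * (fderiv ℝ f x (ebasis d i) / (1 - f x ^ 2)) = (x - y) i / ‖x - y‖ := by
    intro i
    have h1 := ((key x i).1 0).const_mul ε
    have h2 := norm_line (x - y) (ebasis d i) ha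
    have h3 := h1.sub h2
    have h4 := IsLocalMax.hasDerivAt_eq_zero (Filter.Eventually.of_forall fun s => by
      have := hmax (x + s • ebasis d i) y
      have e : x + s • ebasis d i - y = x - y + s • ebasis d i := by abel
      rw [e] at this
      simp only [Pi.sub_apply, zero_smul, add_zero]
      linarith) h3
    rw [inner_ebasis] at h4
    simp only [zero_smul, add_zero] at h4
    linarith
  have gy : ∀ i, ε * (fderiv ℝ f y (ebasis d i) / (1 - f y ^ 2)) = (x - y) i / ‖x - y‖ := by
    intro i
    have h1 := ((key y i).1 0).const_mul ε
    have h2 := norm_line (x - y) (-ebasis d i) ha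
    have h3 := h1.add h2
    have h4 := IsLocalMin.hasDerivAt_eq_zero (Filter.Eventually.of_forall fun s => by
      have := hmax x (y + s • ebasis d i)
      have e : x - (y + s • ebasis d i) = x - y + s • (-ebasis d i) := by
        rw [smul_neg]; abel
      rw [e] at this
      simp only [Pi.add_apply, zero_smul, add_zero]
      linarith) h3
    rw [inner_neg_right, inner_ebasis] at h4
    simp only [zero_smul, add_zero] at h4
    rw [neg_div] at h4
    linarith
  have hsum : ∑ i, ((x - y) i / ‖x - y‖) ^ 2 = 1 := by
    simp_rw [div_pow]
    rw [← Finset.sum_div, ← EuclideanSpace.real_norm_sq_eq]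
    field_simp
  have tot : ∀ z, (∀ i, ε * (fderiv ℝ f z (ebasis d i) / (1 - f z ^ 2)) = (x - y) i / ‖x - y‖) →
      ε * ∑ i, (fderiv ℝ (fun y => fderiv ℝ f y (ebasis d i)) z (ebasis d i) / (1 - f z ^ 2) +
        2 * f z * (fderiv ℝ f z (ebasis d i)) ^ 2 / (1 - f z ^ 2) ^ 2)
      = ε * lap f z / (1 - f z ^ 2) + 2 * f z / ε := by
    intro z hz
    have e : ∀ i, 2 * f z * (fderiv ℝ f z (ebasis d i)) ^ 2 / (1 - f z ^ 2) ^ 2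
        = 2 * f z / ε ^ 2 * ((x - y) i / ‖x - y‖) ^ 2 := by
      intro i
      rw [← hz i]
      have := (one_sub_sq_pos (hb z)).ne'
      field_simp
    simp_rw [e]
    rw [Finset.sum_add_distrib, ← Finset.mul_sum, hsum, ← Finset.sum_div]
    unfold lap
    have := (one_sub_sq_pos (hb z)).ne'
    field_simp
  rw [← tot x gx, ← tot y gy]
  refine mul_le_mul_of_nonneg_left (Finset.sum_le_sum fun i _ => ?_) hε.le
  have := second_nonpos (fun s => ((key x i).1 s).sub ((key y i).1 s))
    ((key x i).2.sub (key y i).2) (fun s => by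
      have := hmax (x + s • ebasis d i) (y + s • ebasis d i)
      rw [add_sub_add_right_eq_sub] at this
      simp only [Pi.sub_apply, zero_smul, add_zero]
      have h2 : ε * (gg (f (x + s • ebasis d i)) - gg (f (y + s • ebasis d i)))
        ≤ ε * (gg (f x) - gg (f y)) := by linarith
      exact le_of_mul_le_mul_left h2 hε)
  linarith

lemma exists_box (d : ℕ) : ∃ R : ℝ, 0 ≤ R ∧ ∀ x : Ed d, ∃ k : Fin d → ℤ,
    ‖x + (WithLp.equiv 2 (Fin d → ℝ)).symm (fun i => (k i : ℝ))‖ ≤ R := by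
  refine ⟨√d, Real.sqrt_nonneg _, fun x => ⟨fun i => -⌊x i⌋, ?_⟩⟩
  apply Real.le_sqrt_of_sq_le
  rw [EuclideanSpace.real_norm_sq_eq]
  calc _ ≤ ∑ i : Fin d, (1 : ℝ) := by
        refine Finset.sum_le_sum fun i _ => ?_
        have h1 := Int.floor_le (x i)
        have h2 := Int.lt_floor_add_one (x i)
        have e : (x + (WithLp.equiv 2 (Fin d → ℝ)).symm (fun i => ((-⌊x i⌋ : ℤ) : ℝ))) i
          = x i - ⌊x i⌋ := by
            simp [Int.self_sub_floor, ← sub_eq_add_neg]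
        rw [e]
        nlinarith
    _ = d := by simp

lemma exists_max {d : ℕ} {r : Ed d → ℝ → ℝ} {T : ℝ} (hT : 0 ≤ T)
    (hc : ContinuousOn (fun p : Ed d × ℝ => r p.1 p.2) {p | 0 ≤ p.2})
    (hper : ∀ t, ZdPeriodic fun x => r x t) (δ : ℝ) (x₁ y₁ : Ed d)
    (h1 : 0 < r x₁ T - r y₁ T - ‖x₁ - y₁‖ - δ * T) (hδ : 0 < δ) :
    ∃ x y t, t ∈ Set.Icc 0 T ∧ 0 < r x t - r y t - ‖x - y‖ - δ * t ∧
      ∀ x' y' s, s ∈ Set.Icc 0 T →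
        r x' s - r y' s - ‖x' - y'‖ - δ * s ≤ r x t - r y t - ‖x - y‖ - δ * t := by
  obtain ⟨R, hR, hbox⟩ := exists_box d
  have hK : IsCompact (Metric.closedBall (0 : Ed d) R ×ˢ Set.Icc 0 T) :=
    (isCompact_closedBall _ _).prod isCompact_Icc
  obtain ⟨M, hM⟩ := hK.exists_bound_of_continuousOn (hc.mono fun p hp => hp.2.1)
  have hMall : ∀ x t, t ∈ Set.Icc 0 T → |r x t| ≤ M := by
    intro x t ht
    obtain ⟨k, hk⟩ := hbox x
    have h := hM (_, t) ⟨mem_closedBall_zero_iff.2 hk, ht⟩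
    have e := hper t x k
    simp only at e
    simp only [e] at h
    exact h
  let Φ : (Ed d × Ed d) × ℝ → ℝ := fun p =>
    r p.1.1 p.2 - r p.1.2 p.2 - ‖p.1.1 - p.1.2‖ - δ * p.2
  let K : Set ((Ed d × Ed d) × ℝ) :=
    (Metric.closedBall (0 : Ed d) R ×ˢ Metric.closedBall (0 : Ed d) (R + 2 * M)) ×ˢ Set.Icc 0 T
  have hKc : IsCompact K :=
    ((isCompact_closedBall _ _).prod (isCompact_closedBall _ _)).prod isCompact_Icc
  have hΦ : ContinuousOn Φ K := by
    have c1 : ContinuousOn (fun p : (Ed d × Ed d) × ℝ => r p.1.1 p.2) K :=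
      hc.comp (f := fun p : (Ed d × Ed d) × ℝ => (p.1.1, p.2)) (by fun_prop) (fun p hp => hp.2.1)
    have c2 : ContinuousOn (fun p : (Ed d × Ed d) × ℝ => r p.1.2 p.2) K :=
      hc.comp (f := fun p : (Ed d × Ed d) × ℝ => (p.1.2, p.2)) (by fun_prop) (fun p hp => hp.2.1)
    exact ((c1.sub c2).sub (by fun_prop)).sub (by fun_prop)
  have trans : ∀ x y t, t ∈ Set.Icc 0 T → 0 < Φ ((x, y), t) →
      ∃ q ∈ K, Φ q = Φ ((x, y), t) := by
    intro x y t ht hp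
    obtain ⟨k, hk⟩ := hbox x
    set v : Ed d := (WithLp.equiv 2 (Fin d → ℝ)).symm (fun i => (k i : ℝ)) with hv
    have ex : r (x + v) t = r x t := hper t x k
    have ey : r (y + v) t = r y t := hper t y k
    have hd : ‖x - y‖ ≤ 2 * M := by
      have a := abs_le.1 (hMall x t ht)
      have b := abs_le.1 (hMall y t ht)
      have c : 0 ≤ δ * t := mul_nonneg hδ.le ht.1
      simp only [Φ] at hp
      linarith [a.2, b.1]
    refine ⟨((x + v, y + v), t), ⟨⟨mem_closedBall_zero_iff.2 hk, mem_closedBall_zero_iff.2 ?_⟩, ht⟩, ?_⟩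
    · have : y + v = (x + v) - (x - y) := by abel
      calc ‖y + v‖ = ‖(x + v) - (x - y)‖ := by rw [this]
        _ ≤ ‖x + v‖ + ‖x - y‖ := norm_sub_le _ _
        _ ≤ R + 2 * M := add_le_add hk hd
    · simp only [Φ, ex, ey, add_sub_add_right_eq_sub]
  have hTT : T ∈ Set.Icc 0 T := ⟨hT, le_rfl⟩
  obtain ⟨q₁, hq₁, e₁⟩ := trans x₁ y₁ T hTT h1
  obtain ⟨q, hq, hqmax⟩ := hKc.exists_isMaxOn ⟨q₁, hq₁⟩ hΦ
  have hpos : 0 < Φ q := by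
    have : Φ q₁ ≤ Φ q := hqmax hq₁
    rw [e₁] at this
    exact lt_of_lt_of_le h1 this
  refine ⟨q.1.1, q.1.2, q.2, hq.2, hpos, fun x' y' s hs => ?_⟩
  by_cases hp : 0 < Φ ((x', y'), s)
  · obtain ⟨q', hq', e'⟩ := trans x' y' s hs hp
    have : Φ q' ≤ Φ q := hqmax hq'
    rw [e'] at this
    exact this
  · exact (not_lt.1 hp).trans hpos.le

/-- non-positivity of the discrepancy for the nonlocal Allen–Cahn
equation with well-prepared initial data. -/
theorem discrepancy_nonpositive {d : ℕ} (hd : 2 ≤ d) (ε : ℝ) (hε : ε ∈ Set.Ioo (0 : ℝ) 1)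
    (lam : ℝ → ℝ) (hlam : ContinuousOn lam (Set.Ici 0))
    (φ : Ed d → ℝ → ℝ)
    (hφ : ContDiff ℝ (⊤ : ℕ∞) (fun p : Ed d × ℝ => φ p.1 p.2))
    (hper : ∀ t, ZdPeriodic fun x => φ x t)
    (hpde : ∀ (x : Ed d) (t : ℝ), 0 ≤ t →
      ε * deriv (φ x) t =
        ε * lap (fun y => φ y t) x - W' (φ x t) / ε + lam t * Real.sqrt (2 * W (φ x t)))
    (hbd : ∀ (x : Ed d) (t : ℝ), 0 ≤ t → |φ x t| < 1)
    (r₀ : Ed d → ℝ) (hr₀ : ContDiff ℝ (⊤ : ℕ∞) r₀) (hr₀per : ZdPeriodic r₀)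
    (hr₀grad : ∀ x, ‖gradient r₀ x‖ ≤ 1)
    (hinit : ∀ x, φ x 0 = Real.tanh (r₀ x / ε)) :
    ∀ (x : Ed d) (t : ℝ), 0 ≤ t →
      ε * ‖gradient (fun y => φ y t) x‖ ^ 2 / 2 - W (φ x t) / ε ≤ 0 := by
  have hε0 : 0 < ε := hε.1
  have hslice : ∀ t, ContDiff ℝ (⊤ : ℕ∞) (fun y => φ y t) := fun t =>
    hφ.comp (contDiff_id.prodMk contDiff_const)
  have htime : ∀ x, Differentiable ℝ (φ x) := fun x =>
    (hφ.comp (contDiff_const.prodMk contDiff_id) :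
      ContDiff ℝ (⊤ : ℕ∞) (fun t => φ x t)).differentiable (by simp)
  -- the 1-Lipschitz bound for r = ε artanh φ
  have hlip : ∀ t, 0 ≤ t → ∀ x y, ε * gg (φ x t) - ε * gg (φ y t) ≤ ‖x - y‖ := by
    intro T hT x₁ y₁
    by_contra hcon
    push Not at hcon
    obtain ⟨δ, hδ, hδT⟩ : ∃ δ : ℝ, 0 < δ ∧
        0 < ε * gg (φ x₁ T) - ε * gg (φ y₁ T) - ‖x₁ - y₁‖ - δ * T := by
      set c := ε * gg (φ x₁ T) - ε * gg (φ y₁ T) - ‖x₁ - y₁‖ with hc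
      have hc0 : 0 < c := by linarith
      refine ⟨c / (T + 1), by positivity, ?_⟩
      have : c - c / (T + 1) * T = c / (T + 1) := by field_simp; ring
      rw [this]; positivity
    obtain ⟨x, y, t, ht, hpos, hmax⟩ := exists_max (r := fun x t => ε * gg (φ x t)) hT
      (by
        intro p hp
        have h1 : ContinuousAt gg (φ p.1 p.2) := (gg_deriv (hbd p.1 p.2 hp)).continuousAt
        have h2 : ContinuousAt (fun p : Ed d × ℝ => φ p.1 p.2) p := hφ.continuous.continuousAt
        have h3 : ContinuousAt (fun p : Ed d × ℝ => gg (φ p.1 p.2)) p :=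
          ContinuousAt.comp (g := gg) (f := fun p : Ed d × ℝ => φ p.1 p.2) h1 h2
        exact (h3.const_mul ε).continuousWithinAt)
      (by
        intro t x k
        have := hper t x k
        simp only at this
        simp only [this])
      δ x₁ y₁ hδT hδ
    have hxy : x ≠ y := by
      rintro rfl
      have : 0 ≤ δ * t := mul_nonneg hδ.le ht.1
      simp at hpos
      linarith
    have ht0 : 0 < t := by
      rcases ht.1.lt_or_eq with h | h
      · exact h
      · exfalso
        subst h
        simp only [hinit, gg_tanh] at hpos
        rw [mul_div_cancel₀ _ hε0.ne', mul_div_cancel₀ _ hε0.ne'] at hpos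
        have hl : ‖r₀ x - r₀ y‖ ≤ 1 * ‖x - y‖ :=
          convex_univ.norm_image_sub_le_of_norm_fderiv_le (𝕜 := ℝ)
            (fun z _ => (hr₀.differentiable (by simp)) z)
            (fun z _ => by
              rw [← toDual_gradient, LinearIsometryEquiv.norm_map]
              exact hr₀grad z) (mem_univ y) (mem_univ x)
        have := le_abs_self (r₀ x - r₀ y)
        rw [Real.norm_eq_abs] at hl
        linarith
    have hsp := spatial hε0 (hslice t) (fun z => hbd z t ht.1) x y hxy (fun x' y' => by
      have := hmax x' y' t ht
      linarith)
    have hdt : ∀ z, HasDerivAt (fun s => ε * gg (φ z s))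
        (ε * lap (fun y => φ y t) z / (1 - φ z t ^ 2) + 2 * φ z t / ε + lam t) t := by
      intro z
      have hb := hbd z t ht.1
      have h1 := (((gg_deriv hb).comp t (htime z t).hasDerivAt).const_mul ε)
      refine h1.congr_deriv ?_
      have hp := one_sub_sq_pos hb
      have hs : Real.sqrt (2 * W (φ z t)) = 1 - φ z t ^ 2 := by
        unfold W
        rw [mul_div_cancel₀ _ (two_ne_zero), Real.sqrt_sq hp.le]
      have hpd := hpde z t ht.1
      rw [hs] at hpd
      have e : ε * (1 / (1 - φ z t ^ 2) * deriv (φ z) t)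
        = (ε * deriv (φ z) t) / (1 - φ z t ^ 2) := by ring
      rw [e, hpd]
      unfold W'
      have := hp.ne'
      field_simp
      ring
    have htd := left_deriv ((((hdt x).sub (hdt y)).sub_const ‖x - y‖).sub
      ((hasDerivAt_id t).const_mul δ)) ht0 (fun s hs => by
        have := hmax x y s ⟨hs.1, hs.2.trans ht.2⟩
        simpa using this)
    linarith
  intro x t ht
  have hb := hbd x t ht
  have hp := one_sub_sq_pos hb
  have hfd := ((hslice t).differentiable (by simp) x).hasFDerivAt
  have h1 := ((gg_deriv hb).comp_hasFDerivAt x hfd).const_mul ε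
  have h2 := h1.le_of_lip' (C := 1) zero_le_one (Filter.Eventually.of_forall fun y => by
    rw [one_mul, Real.norm_eq_abs, abs_le]
    have a := hlip t ht x y
    have b := hlip t ht y x
    rw [norm_sub_rev] at a
    simp only [Function.comp_apply]
    constructor <;> linarith)
  rw [norm_smul, norm_smul, ← toDual_gradient, LinearIsometryEquiv.norm_map, Real.norm_eq_abs,
    Real.norm_eq_abs, abs_of_pos hε0, abs_of_pos (by positivity)] at h2
  set G := ‖gradient (fun y => φ y t) x‖ with hG
  have hG0 : 0 ≤ G := norm_nonneg _
  have h3 : ε * G ≤ 1 - φ x t ^ 2 := by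
    have e : ε * (1 / (1 - φ x t ^ 2) * G) = ε * G / (1 - φ x t ^ 2) := by ring
    rw [e, div_le_one hp] at h2
    exact h2
  have h4 : (ε * G) ^ 2 ≤ (1 - φ x t ^ 2) ^ 2 := pow_le_pow_left₀ (by positivity) h3 2
  unfold W
  have e : ε * G ^ 2 / 2 - (1 - φ x t ^ 2) ^ 2 / 2 / ε
    = ((ε * G) ^ 2 - (1 - φ x t ^ 2) ^ 2) / (2 * ε) := by field_simp
  rw [e]
  exact div_nonpos_of_nonpos_of_nonneg (by linarith) (by positivity)
end
end

section
/- Let d ≥ 2 and ε ∈ (0,1). Let λ : [0,∞) → ℝ be continuous and let φ : ℝ^d × [0,∞) → ℝ be a smooth ℤ^d-periodic (in x) solution of ε∂_tφ = εΔφ − W'(φ)/ε + λ(t)√(2W(φ)) with |φ(x,0)| ≤ 1 for all x. Then |φ(x,t)| ≤ 1 for all (x,t) ∈ ℝ^d × [0,∞). -/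
open MeasureTheory Real Set

noncomputable section

lemma second_deriv_nonpos {d : ℕ} (f : Ed d → ℝ) (hf : ContDiff ℝ (⊤ : ℕ∞) f) (x e : Ed d)
    (hmax : ∀ y, f y ≤ f x) : fderiv ℝ (fun y => fderiv ℝ f y e) x e ≤ 0 := by
  have hfd : Differentiable ℝ f := hf.differentiable (by simp)
  have hf2 : Differentiable ℝ (fun y => fderiv ℝ f y e) := by
    have : ContDiff ℝ 1 (fun y => fderiv ℝ f y e) :=
      (hf.fderiv_right (m := 1) (by
        rw [show (1 : WithTop ℕ∞) + 1 = ((2 : ℕ∞) : WithTop ℕ∞) by norm_num]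
        exact WithTop.coe_le_coe.2 le_top)).clm_apply contDiff_const
    exact this.differentiable (by simp)
  have hl : ∀ s : ℝ, HasDerivAt (fun s : ℝ => x + s • e) e s := fun s => by
    simpa using ((hasDerivAt_id s).smul_const e).const_add x
  have h1 : ∀ s : ℝ, HasDerivAt (fun s : ℝ => f (x + s • e)) (fderiv ℝ f (x + s • e) e) s :=
    fun s => (hfd (x + s • e)).hasFDerivAt.comp_hasDerivAt s (hl s)
  have h1' : deriv (fun s : ℝ => f (x + s • e)) = fun s => fderiv ℝ f (x + s • e) e :=
    funext fun s => (h1 s).deriv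
  have h2 : HasDerivAt (fun s : ℝ => fderiv ℝ f (x + s • e) e)
      (fderiv ℝ (fun y => fderiv ℝ f y e) (x + (0:ℝ) • e) e) 0 :=
    HasFDerivAt.comp_hasDerivAt (l := fun y => fderiv ℝ f y e) 0
      (hf2 (x + (0:ℝ) • e)).hasFDerivAt (hl 0)
  rw [zero_smul, add_zero] at h2
  by_contra! hpos
  have hM : IsLocalMax (fun s : ℝ => f (x + s • e)) 0 :=
    Filter.Eventually.of_forall fun s => by simpa using hmax _
  have hm : IsLocalMin (fun s : ℝ => f (x + s • e)) 0 := by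
    apply isLocalMin_of_deriv_deriv_pos
    · rw [h1', h2.deriv]; exact hpos
    · exact hM.deriv_eq_zero
    · exact (h1 0).continuousAt
  have hc : (fun s : ℝ => f (x + s • e)) =ᶠ[nhds 0] fun _ => f (x + (0:ℝ) • e) := by
    filter_upwards [hM, hm] with s a b using le_antisymm a b
  have := hc.deriv.deriv_eq
  rw [h1', h2.deriv] at this
  simp at this
  linarith

lemma left_deriv_nonneg (h : ℝ → ℝ) (h' t : ℝ) (ht : 0 < t) (hd : HasDerivAt h h' t)
    (hmax : ∀ s ∈ Icc 0 t, h s ≤ h t) : 0 ≤ h' := by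
  have hm : IsLocalMaxOn h (Icc 0 t) t := Filter.eventually_of_mem self_mem_nhdsWithin hmax
  have hs : segment ℝ t 0 ⊆ Icc 0 t := by
    rw [segment_symm, segment_eq_Icc ht.le]
  have := hm.hasFDerivWithinAt_nonpos hd.hasFDerivAt.hasFDerivWithinAt
    (sub_mem_posTangentConeAt_of_segment_subset hs)
  simp at this
  by_contra! hh
  nlinarith

lemma upper_bound {d : ℕ} (ε : ℝ) (hε : ε ∈ Set.Ioo (0 : ℝ) 1)
    (lam : ℝ → ℝ) (hlam : ContinuousOn lam (Set.Ici 0))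
    (φ : Ed d → ℝ → ℝ)
    (hφ : ContDiff ℝ (⊤ : ℕ∞) (fun p : Ed d × ℝ => φ p.1 p.2))
    (hper : ∀ t, ZdPeriodic fun x => φ x t)
    (hpde : ∀ (x : Ed d) (t : ℝ), 0 ≤ t →
      ε * deriv (φ x) t =
        ε * lap (fun y => φ y t) x - W' (φ x t) / ε + lam t * Real.sqrt (2 * W (φ x t)))
    (hinit : ∀ x : Ed d, φ x 0 ≤ 1) (x : Ed d) (T : ℝ) (hT : 0 ≤ T) : φ x T ≤ 1 := by
  obtain ⟨hε0, hε1⟩ := hε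
  obtain ⟨L, hL⟩ := isCompact_Icc.exists_bound_of_continuousOn
    (hlam.mono (Icc_subset_Ici_self : Icc 0 T ⊆ Ici 0))
  have hL0 : 0 ≤ L := (norm_nonneg _).trans (hL 0 ⟨le_rfl, hT⟩)
  set K : ℝ := (L ^ 2 + L + 2) / ε with hK
  have hKε : ε * K = L ^ 2 + L + 2 := by rw [hK]; field_simp
  let Q : Set (Ed d) := WithLp.toLp 2 '' (Set.pi univ fun _ : Fin d => Icc (0:ℝ) 1)
  have hQ : IsCompact Q :=
    (isCompact_univ_pi fun _ => isCompact_Icc).image (PiLp.continuous_toLp 2 _)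
  have hred : ∀ y : Ed d, ∃ z ∈ Q, ∀ t, φ y t = φ z t := by
    intro y
    refine ⟨y + (WithLp.equiv 2 (Fin d → ℝ)).symm fun i => ((-⌊y i⌋ : ℤ) : ℝ), ?_, ?_⟩
    · refine ⟨fun i => Int.fract (y i), ?_, ?_⟩
      · intro i _
        exact ⟨Int.fract_nonneg _, (Int.fract_lt_one _).le⟩
      · ext i
        simp [Int.fract, sub_eq_add_neg]
    · intro t
      exact (hper t y _).symm
  let v : Ed d × ℝ → ℝ := fun p => Real.exp (-K * p.2) * (φ p.1 p.2 - 1)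
  have hv : Continuous v := by
    have := hφ.continuous
    fun_prop
  obtain ⟨x', hx', hxx'⟩ := hred x
  obtain ⟨⟨x0, t0⟩, ⟨hx0, ht0⟩, hm⟩ := (hQ.prod (isCompact_Icc (a := (0:ℝ)) (b := T))).exists_isMaxOn
    ⟨(x', T), hx', hT, le_rfl⟩ hv.continuousOn
  have hm' : ∀ y, ∀ t ∈ Icc 0 T, v (y, t) ≤ v (x0, t0) := by
    intro y t ht
    obtain ⟨z, hz, hyz⟩ := hred y
    have : v (y, t) = v (z, t) := by simp [v, hyz]
    rw [this]
    exact hm (show (z, t) ∈ Q ×ˢ Icc 0 T from ⟨hz, ht⟩)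
  simp only at hx0 ht0
  by_contra! hgt
  have hpos : 0 < v (x0, t0) := lt_of_lt_of_le
    (mul_pos (Real.exp_pos _) (by simpa using hgt)) (hm' x T ⟨hT, le_rfl⟩)
  have hs1 : 1 < φ x0 t0 := by
    have := (pos_iff_pos_of_mul_pos hpos).1 (Real.exp_pos _)
    simpa using this
  have ht0' : 0 < t0 := by
    rcases ht0.1.eq_or_lt with h | h
    · rw [← h] at hs1
      exact absurd (hinit x0) (not_le.2 hs1)
    · exact h
  have hsp : ∀ y, φ y t0 ≤ φ x0 t0 := by
    intro y
    have := hm' y t0 ht0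
    have := le_of_mul_le_mul_left this (Real.exp_pos _)
    simpa using this
  have hlap : lap (fun y => φ y t0) x0 ≤ 0 := by
    apply Finset.sum_nonpos
    intro i _
    apply second_deriv_nonpos (fun y => φ y t0) _ x0 _ hsp
    exact hφ.comp (contDiff_id.prodMk contDiff_const)
  have hdt : DifferentiableAt ℝ (φ x0) t0 := by
    have : ContDiff ℝ (⊤ : ℕ∞) (φ x0) := hφ.comp (contDiff_const.prodMk contDiff_id)
    exact this.differentiable (by simp) t0
  have hexp : HasDerivAt (fun t : ℝ => Real.exp (-K * t)) (Real.exp (-K * t0) * (-K)) t0 := by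
    simpa using ((hasDerivAt_id t0).const_mul (-K)).exp
  have hder := hexp.mul (hdt.hasDerivAt.sub_const 1)
  have hge := left_deriv_nonneg _ _ t0 ht0' hder
    (fun s hs => hm' x0 s ⟨hs.1, hs.2.trans ht0.2⟩)
  have hge' : K * (φ x0 t0 - 1) ≤ deriv (φ x0) t0 := by
    have h3 : 0 ≤ Real.exp (-K * t0) * (deriv (φ x0) t0 - K * (φ x0 t0 - 1)) := by
      linarith
    have := nonneg_of_mul_nonneg_right h3 (Real.exp_pos _)
    linarith
  have hp := hpde x0 t0 ht0.1
  have hLt := hL t0 ht0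
  rw [Real.norm_eq_abs] at hLt
  have hlt := (abs_le.1 hLt).2
  generalize φ x0 t0 = s at *
  have hsq : Real.sqrt (2 * W s) = s ^ 2 - 1 := by
    have : 2 * W s = (s ^ 2 - 1) ^ 2 := by unfold W; ring
    rw [this, Real.sqrt_sq (by nlinarith)]
  rw [hsq] at hp
  have hW : 0 ≤ W' s := by unfold W'; nlinarith [mul_pos (sub_pos.2 hs1) (by linarith : 0 < s)]
  have hW1 : W' s ≤ W' s / ε := by
    rw [le_div_iff₀ hε0]; nlinarith
  have hlm : lam t0 * (s ^ 2 - 1) ≤ L * (s ^ 2 - 1) :=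
    mul_le_mul_of_nonneg_right hlt (by nlinarith)
  have h5 : ε * (K * (s - 1)) ≤ ε * deriv (φ x0) t0 := mul_le_mul_of_nonneg_left hge' hε0.le
  have h6 : ε * lap (fun y => φ y t0) x0 ≤ 0 := mul_nonpos_of_nonneg_of_nonpos hε0.le hlap
  have h7 : (L ^ 2 + L + 2) * (s - 1) ≤ (s - 1) * ((s + 1) * (L - 2 * s)) := by
    have e1 : (L ^ 2 + L + 2) * (s - 1) = ε * (K * (s - 1)) := by rw [← hKε]; ring
    have e2 : (s - 1) * ((s + 1) * (L - 2 * s)) = L * (s ^ 2 - 1) - W' s := by unfold W'; ring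
    rw [e1, e2]; linarith
  have h8 : L ^ 2 + L + 2 ≤ (s + 1) * (L - 2 * s) := by
    rw [mul_comm] at h7
    exact le_of_mul_le_mul_left h7 (by linarith)
  nlinarith [sq_nonneg (s - L), sq_nonneg s, sq_nonneg L]

/-- the maximum principle bound |φ| ≤ 1 is preserved. -/
theorem sup_bound_one {d : ℕ} (hd : 2 ≤ d) (ε : ℝ) (hε : ε ∈ Set.Ioo (0 : ℝ) 1)
    (lam : ℝ → ℝ) (hlam : ContinuousOn lam (Set.Ici 0))
    (φ : Ed d → ℝ → ℝ)
    (hφ : ContDiff ℝ (⊤ : ℕ∞) (fun p : Ed d × ℝ => φ p.1 p.2))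
    (hper : ∀ t, ZdPeriodic fun x => φ x t)
    (hpde : ∀ (x : Ed d) (t : ℝ), 0 ≤ t →
      ε * deriv (φ x) t =
        ε * lap (fun y => φ y t) x - W' (φ x t) / ε + lam t * Real.sqrt (2 * W (φ x t)))
    (hinit : ∀ x : Ed d, |φ x 0| ≤ 1) :
    ∀ (x : Ed d) (t : ℝ), 0 ≤ t → |φ x t| ≤ 1 := by
  have hup := upper_bound ε hε lam hlam φ hφ hper hpde (fun x => (abs_le.1 (hinit x)).2)
  have hlow := upper_bound ε hε (fun t => -lam t) hlam.neg (fun x t => -φ x t) hφ.neg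
    (fun t x k => congrArg Neg.neg (hper t x k)) (by
      intro x t ht
      have h := hpde x t ht
      have h1 : deriv (fun t => -φ x t) t = -deriv (φ x) t := deriv.fun_neg
      have h2 : lap (fun y => -φ y t) x = -lap (fun y => φ y t) x := by
        unfold lap
        simp [fderiv_fun_neg]
      have h3 : W' (-φ x t) = -W' (φ x t) := by unfold W'; ring
      have h4 : W (-φ x t) = W (φ x t) := by unfold W; ring
      rw [h1, h2, h3, h4, neg_div]
      linarith) (fun x => by linarith [(abs_le.1 (hinit x)).1])
  intro x t ht
  exact abs_le.2 ⟨by linarith [hlow x t ht], hup x t ht⟩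
end
end

section
/- Let d ≥ 2, ε ∈ (0,1), and let η ∈ C_c^∞(ℝ^d) be radially symmetric with support in the ball B_{1/2}(0), η = 1 on B_{1/4}(0) and 0 ≤ η ≤ 1. Define, for y ∈ ℝ^d and t < s, ρ̃_{(y,s)}(x,t) := (4π(s−t))^{−(d−1)/2} e^{−|x−y|²/(4(s−t))} η(x−y). Let λ : [0,∞) → ℝ be continuous and let φ : ℝ^d × [0,∞) → ℝ be a smooth ℤ^d-periodic (in x) solution of ε∂_tφ = εΔφ − W'(φ)/ε + λ(t)√(2W(φ)) satisfying the discrepancy bound ε|∇φ|²/2 ≤ W(φ)/ε everywhere. Then there exists c₅ > 0 depending only on d and η such that for all y ∈ ℝ^d, s > 0 and 0 ≤ t₁ < t₂ < s: ∫_{ℝ^d} ρ̃_{(y,s)}(x,t₂) dμ^ε_{t₂}(x) ≤ ( ∫_{ℝ^d} ρ̃_{(y,s)}(x,t₁) dμ^ε_{t₁}(x) + c₅ ∫_{t₁}^{t₂} e^{−1/(128(s−t))} μ^ε_t(B_{1/2}(y)) dt ) · exp( ∫_{t₁}^{t₂} λ(t)² dt ), where μ^ε_t is the measure on ℝ^d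 with density σ^{−1}(ε|∇φ(·,t)|²/2 + W(φ(·,t))/ε) with respect to Lebesgue measure. -/
open MeasureTheory Real Set

noncomputable section

/-- σ = ∫_{-1}^1 √(2W) = 4/3. -/
def sig : ℝ := 4 / 3

/-- Density of the measure μ^ε_t: σ⁻¹ (ε|∇φ|²/2 + W(φ)/ε). -/
def dens {d : ℕ} (ε : ℝ) (φ : Ed d → ℝ → ℝ) (x : Ed d) (t : ℝ) : ℝ :=
  sig⁻¹ * (ε * ‖gradient (fun y => φ y t) x‖ ^ 2 / 2 + W (φ x t) / ε)

/-- The localized backward heat kernel ρ̃_{(y,s)}(x,t). -/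
def rhoTilde {d : ℕ} (η : Ed d → ℝ) (y : Ed d) (s : ℝ) (x : Ed d) (t : ℝ) : ℝ :=
  (4 * Real.pi * (s - t)) ^ (-(((d : ℝ) - 1) / 2)) *
    Real.exp (-‖x - y‖ ^ 2 / (4 * (s - t))) * η (x - y)


/-- partial derivative -/
def pd {d : ℕ} (i : Fin d) (f : Ed d → ℝ) (x : Ed d) : ℝ := fderiv ℝ f x (ebasis d i)

lemma lap_eq {d : ℕ} (f : Ed d → ℝ) (x : Ed d) : lap f x = ∑ i, pd i (pd i f) x := rfl

lemma pd_smooth {d : ℕ} (i : Fin d) {f : Ed d → ℝ} (hf : ContDiff ℝ (⊤ : ℕ∞) f) :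
    ContDiff ℝ (⊤ : ℕ∞) (pd i f) := by
  unfold pd
  exact (hf.fderiv_right (m := (⊤ : ℕ∞)) (by simp)).clm_apply contDiff_const

lemma sm_diff {E : Type*} [NormedAddCommGroup E] [NormedSpace ℝ E] {f : E → ℝ}
    (hf : ContDiff ℝ (⊤ : ℕ∞) f) (x : E) : DifferentiableAt ℝ f x :=
  (hf.differentiable (by simp)) x

lemma pd_add {d : ℕ} (i : Fin d) {f g : Ed d → ℝ} {x : Ed d} (hf : DifferentiableAt ℝ f x)
    (hg : DifferentiableAt ℝ g x) : pd i (fun x => f x + g x) x = pd i f x + pd i g x := by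
  unfold pd; rw [fderiv_fun_add hf hg]; rfl

lemma pd_sub {d : ℕ} (i : Fin d) {f g : Ed d → ℝ} {x : Ed d} (hf : DifferentiableAt ℝ f x)
    (hg : DifferentiableAt ℝ g x) : pd i (fun x => f x - g x) x = pd i f x - pd i g x := by
  unfold pd; rw [fderiv_fun_sub hf hg]; rfl

lemma pd_mul {d : ℕ} (i : Fin d) {f g : Ed d → ℝ} {x : Ed d} (hf : DifferentiableAt ℝ f x)
    (hg : DifferentiableAt ℝ g x) :
    pd i (fun x => f x * g x) x = pd i f x * g x + f x * pd i g x := by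
  unfold pd; rw [fderiv_fun_mul hf hg]; simp; ring

lemma pd_const_mul {d : ℕ} (i : Fin d) {g : Ed d → ℝ} {x : Ed d} (c : ℝ)
    (hg : DifferentiableAt ℝ g x) :
    pd i (fun x => c * g x) x = c * pd i g x := by
  unfold pd; rw [fderiv_const_mul hg]; simp

lemma pd_sum {d : ℕ} (i : Fin d) {f : Fin d → Ed d → ℝ} {x : Ed d}
    (hf : ∀ j, DifferentiableAt ℝ (f j) x) :
    pd i (fun x => ∑ j, f j x) x = ∑ j, pd i (f j) x := by
  unfold pd; rw [fderiv_fun_sum (fun j _ => hf j)]; simp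

lemma pd_comp {d : ℕ} (i : Fin d) {g : Ed d → ℝ} {x : Ed d} {h : ℝ → ℝ} {h' : ℝ}
    (hh : HasDerivAt h h' (g x)) (hg : DifferentiableAt ℝ g x) :
    pd i (fun x => h (g x)) x = h' * pd i g x := by
  unfold pd
  have := (hh.comp_hasFDerivAt x hg.hasFDerivAt).fderiv
  simp only [Function.comp_def] at this
  rw [this]; simp

lemma snd_symm {E : Type*} [NormedAddCommGroup E] [NormedSpace ℝ E] {f : E → ℝ}
    (hf : ContDiff ℝ (⊤ : ℕ∞) f) (v w : E) (x : E) :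
    fderiv ℝ (fun y => fderiv ℝ f y v) x w = fderiv ℝ (fun y => fderiv ℝ f y w) x v := by
  have h1 : DifferentiableAt ℝ (fderiv ℝ f) x :=
    ((hf.fderiv_right (m := (⊤ : ℕ∞)) (by simp)).differentiable (by simp)) x
  have h2 : IsSymmSndFDerivAt ℝ f x := (hf.contDiffAt).isSymmSndFDerivAt (by simp only [minSmoothness_of_isRCLikeNormedField]; exact WithTop.coe_le_coe.2 (le_top (a := (2 : ℕ∞))))
  rw [fderiv_clm_apply h1 (differentiableAt_const v), fderiv_clm_apply h1 (differentiableAt_const w)]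
  simpa using h2 w v

lemma pd_comm {d : ℕ} (i j : Fin d) {f : Ed d → ℝ} (hf : ContDiff ℝ (⊤ : ℕ∞) f) (x : Ed d) :
    pd i (pd j f) x = pd j (pd i f) x := snd_symm hf _ _ x

lemma int_pd {d : ℕ} (i : Fin d) {g : Ed d → ℝ} (hg : ContDiff ℝ (⊤ : ℕ∞) g)
    (hc : HasCompactSupport g) : Integrable (pd i g) ∧ ∫ x, pd i g x = 0 := by
  have hI : Integrable (pd i g) := by
    refine (pd_smooth i hg).continuous.integrable_of_hasCompactSupport ?_
    exact hc.fderiv_apply (𝕜 := ℝ) _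
  refine ⟨hI, ?_⟩
  have := integral_mul_fderiv_eq_neg_fderiv_mul_of_integrable (μ := (volume : Measure (Ed d)))
    (f := fun _ : Ed d => (1 : ℝ)) (g := g) (v := ebasis d i) (by simp)
    (by simpa [pd] using (show Integrable (fun x => fderiv ℝ g x (ebasis d i)) volume from hI)) (by simpa using hg.continuous.integrable_of_hasCompactSupport hc)
    (by simp) (fun x _ => sm_diff hg x)
  simpa [pd] using this

lemma W_deriv (s : ℝ) : HasDerivAt W (W' s) s := by
  unfold W W'
  have := (((hasDerivAt_id s).pow 2).const_sub 1).pow 2 |>.div_const 2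
  refine this.congr_deriv ?_
  simp; ring

lemma W_smooth : ContDiff ℝ (⊤ : ℕ∞) W := by unfold W; fun_prop

lemma W_nonneg (s : ℝ) : 0 ≤ W s := by unfold W; positivity

/-- energy density -/
def en {d : ℕ} (ε : ℝ) (f : Ed d → ℝ) (x : Ed d) : ℝ :=
  ε / 2 * (∑ j, pd j f x * pd j f x) + ε⁻¹ * W (f x)

lemma en_smooth {d : ℕ} (ε : ℝ) {f : Ed d → ℝ} (hf : ContDiff ℝ (⊤ : ℕ∞) f) :
    ContDiff ℝ (⊤ : ℕ∞) (en ε f) := by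
  unfold en
  have := fun j => pd_smooth j hf
  have h2 := W_smooth.comp hf
  simp only [Function.comp_def] at h2
  fun_prop

/-- the vector field -/
def XX {d : ℕ} (ε : ℝ) (f g R : Ed d → ℝ) (i : Fin d) (x : Ed d) : ℝ :=
  ε * (g x * (R x * pd i f x)) + ε * ((∑ j, pd j R x * pd j f x) * pd i f x) - en ε f x * pd i R x

lemma XX_smooth {d : ℕ} (ε : ℝ) {f g R : Ed d → ℝ} (hf : ContDiff ℝ (⊤ : ℕ∞) f)
    (hg : ContDiff ℝ (⊤ : ℕ∞) g) (hR : ContDiff ℝ (⊤ : ℕ∞) R) (i : Fin d) :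
    ContDiff ℝ (⊤ : ℕ∞) (XX ε f g R i) := by
  unfold XX
  have := fun j => pd_smooth j hf
  have h3 := fun j => pd_smooth j hR
  have h2 := en_smooth ε hf
  fun_prop

lemma XX_supp {d : ℕ} (ε : ℝ) {f g R : Ed d → ℝ} (hc : HasCompactSupport R) (i : Fin d) :
    HasCompactSupport (XX ε f g R i) := by
  refine HasCompactSupport.intro hc.isCompact (fun x hx => ?_)
  have h0 : R x = 0 := image_eq_zero_of_notMem_tsupport hx
  have h1 : ∀ j, pd j R x = 0 := fun j => by
    have := fderiv_of_notMem_tsupport (𝕜 := ℝ) hx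
    unfold pd; rw [this]; simp
  simp [XX, h0, h1]

lemma div_XX {d : ℕ} (ε : ℝ) {f g R : Ed d → ℝ} (hf : ContDiff ℝ (⊤ : ℕ∞) f)
    (hg : ContDiff ℝ (⊤ : ℕ∞) g) (hR : ContDiff ℝ (⊤ : ℕ∞) R) (x : Ed d) :
    ∑ i, pd i (XX ε f g R i) x =
      ε * R x * (∑ i, pd i f x * pd i g x) + ε * g x * (∑ i, pd i R x * pd i f x)
      + ε * g x * R x * lap f x + ε * (∑ i, ∑ j, pd i (pd j R) x * (pd i f x * pd j f x))
      + (∑ i, pd i R x * pd i f x) * (ε * lap f x - ε⁻¹ * W' (f x))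
      - en ε f x * lap R x := by
  have key : ∀ i, pd i (XX ε f g R i) x =
      ε * (pd i g x * (R x * pd i f x) + g x * (pd i R x * pd i f x + R x * pd i (pd i f) x))
      + ε * ((∑ j, (pd i (pd j R) x * pd j f x + pd j R x * pd i (pd j f) x)) * pd i f x +
        (∑ j, pd j R x * pd j f x) * pd i (pd i f) x)
      - ((ε / 2 * (∑ j, (pd i (pd j f) x * pd j f x + pd j f x * pd i (pd j f) x))
          + ε⁻¹ * (W' (f x) * pd i f x)) * pd i R x + en ε f x * pd i (pd i R) x) := by
    intro i
    have df := fun j => sm_diff (pd_smooth j hf) x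
    have dR := fun j => sm_diff (pd_smooth j hR) x
    have df0 := sm_diff hf x
    have dg0 := sm_diff hg x
    have dR0 := sm_diff hR x
    have de := sm_diff (en_smooth ε hf) x
    have dW : DifferentiableAt ℝ (fun x => W (f x)) x := sm_diff (W_smooth.comp hf) x
    have e1 : pd i (en ε f) x = ε / 2 * (∑ j, (pd i (pd j f) x * pd j f x + pd j f x * pd i (pd j f) x))
          + ε⁻¹ * (W' (f x) * pd i f x) := by
      unfold en
      rw [pd_add i (by fun_prop) (by fun_prop), pd_const_mul i _ (by fun_prop),
        pd_const_mul i _ (by fun_prop), pd_sum i (by fun_prop), pd_comp i (W_deriv _) df0]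
      simp_rw [fun j => pd_mul i (df j) (df j)]
    unfold XX
    rw [pd_sub i (by fun_prop) (by fun_prop), pd_add i (by fun_prop) (by fun_prop),
      pd_const_mul i _ (by fun_prop), pd_const_mul i _ (by fun_prop),
      pd_mul i dg0 (by fun_prop), pd_mul i dR0 (df i), pd_mul i (by fun_prop) (df i),
      pd_mul i de (dR i), e1, pd_sum i (by fun_prop)]
    simp_rw [fun j => pd_mul i (dR j) (df j)]
  simp_rw [key]
  simp only [Finset.sum_add_distrib, Finset.sum_sub_distrib, Finset.sum_mul, mul_add, add_mul,
    Finset.mul_sum, lap_eq, mul_sub]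
  have s1 : ∑ i, ∑ j, ε * (pd j R x * pd i (pd j f) x * pd i f x) =
      ∑ i, ∑ j, ε * (pd i R x * pd i (pd j f) x * pd j f x) := by
    rw [Finset.sum_comm]
    refine Finset.sum_congr rfl fun i _ => Finset.sum_congr rfl fun j _ => ?_
    rw [pd_comm i j hf]
  rw [s1]
  have s2 : ∑ i, ∑ j, ε / 2 * (pd i (pd j f) x * pd j f x) * pd i R x
      + ∑ i, ∑ j, ε / 2 * (pd j f x * pd i (pd j f) x) * pd i R x =
      ∑ i, ∑ j, ε * (pd i R x * pd i (pd j f) x * pd j f x) := by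
    simp only [← Finset.sum_add_distrib]
    refine Finset.sum_congr rfl fun i _ => Finset.sum_congr rfl fun j _ => ?_
    ring
  rw [s2]
  have a1 : ∑ i, ε * (pd i g x * (R x * pd i f x)) = ∑ i, ε * R x * (pd i f x * pd i g x) :=
    Finset.sum_congr rfl fun i _ => by ring
  have a2 : ∑ i, ε * (g x * (pd i R x * pd i f x)) = ∑ i, ε * g x * (pd i R x * pd i f x) :=
    Finset.sum_congr rfl fun i _ => by ring
  have a3 : ∑ i, ε * (g x * (R x * pd i (pd i f) x)) = ∑ i, ε * g x * R x * pd i (pd i f) x :=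
    Finset.sum_congr rfl fun i _ => by ring
  have a4 : ∑ i, ∑ j, ε * (pd i (pd j R) x * pd j f x * pd i f x) =
      ∑ i, ∑ j, ε * (pd i (pd j R) x * (pd i f x * pd j f x)) :=
    Finset.sum_congr rfl fun i _ => Finset.sum_congr rfl fun j _ => by ring
  have a5 : ∑ i, ∑ j, ε * (pd j R x * pd j f x * pd i (pd i f) x) =
      ∑ i, ∑ j, pd j R x * pd j f x * (ε * pd i (pd i f) x) :=
    Finset.sum_congr rfl fun i _ => Finset.sum_congr rfl fun j _ => by ring
  have a6 : ∑ i, ε⁻¹ * (W' (f x) * pd i f x) * pd i R x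
      = ∑ i, pd i R x * pd i f x * (ε⁻¹ * W' (f x)) :=
    Finset.sum_congr rfl fun i _ => by ring
  rw [a1, a2, a3, a4, a5, a6]
  ring_nf
  try (rw [Finset.sum_comm]; ring_nf)

set_option maxHeartbeats 1000000 in
lemma alg_ineq (q η r ε V w a β γ ζ L N B lam S K g : ℝ) (dd Lf Wp Y : ℝ)
    (hq : 0 ≤ q) (hη : 0 ≤ η) (hr : 0 < r) (hε : 0 < ε) (hV : 0 ≤ V) (hw : 0 ≤ w)
    (hdisc : ε / 2 * V ≤ ε⁻¹ * w) (hS : S ^ 2 = 2 * w) (hB : B = ε * Lf - ε⁻¹ * Wp)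
    (hg : ε * g = B + lam * S) (hK : 0 ≤ K)
    (hL : |L| ≤ K) (hζ : |ζ| ≤ K) (hγ : |γ| ≤ K * V) (hβ : β ^ 2 ≤ K * η * V) :
    q * η * ((dd - 1) / (2 * r) - N / (4 * r ^ 2)) * (ε / 2 * V + ε⁻¹ * w)
      + q * η * (ε * Y + ε⁻¹ * Wp * g)
      - (ε * (q * η) * Y + ε * g * (q * (-(η / (2 * r)) * a + β)) + ε * g * (q * η) * Lf
        + ε * (q * ((η / (4 * r ^ 2)) * a ^ 2 - a * β / r - η * V / (2 * r) + γ))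
        + (q * (-(η / (2 * r)) * a + β)) * (ε * Lf - ε⁻¹ * Wp)
        - (ε / 2 * V + ε⁻¹ * w) *
          (q * (η * N / (4 * r ^ 2) - dd * η / (2 * r) - ζ / r + L)))
    ≤ lam ^ 2 * (q * η * (ε / 2 * V + ε⁻¹ * w))
      + q * (3 * K + K / r) * (ε / 2 * V + ε⁻¹ * w) := by
  set e := ε / 2 * V + ε⁻¹ * w with he
  have hee : 0 ≤ e := by positivity
  have hVe : ε * V ≤ e := by rw [he]; linarith
  set α := -(a / (2 * r)) with hα
  set h := lam * S with hh
  -- square step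
  have sq : -(2 * B + h) * (η * α + β) - (B ^ 2 + h * B) * η / ε
      ≤ ε * (η * α ^ 2 + 2 * α * β + K * V) + η * h ^ 2 / (4 * ε) := by
    rcases hη.eq_or_lt with h0 | h0
    · have : β = 0 := by
        rw [← h0] at hβ
        have : β ^ 2 = 0 := le_antisymm (by simpa using hβ) (sq_nonneg _)
        exact pow_eq_zero_iff (two_ne_zero) |>.1 this
      rw [← h0, this]; simp; positivity
    · obtain ⟨b', rfl⟩ : ∃ b', β = η * b' := ⟨β / η, by field_simp⟩
      have h2 : η * b' ^ 2 ≤ K * V := by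
        have : η * (η * b' ^ 2) ≤ η * (K * V) := by nlinarith
        exact le_of_mul_le_mul_left this h0
      have h3 : -(2 * B + h) * (η * α + η * b') - (B ^ 2 + h * B) * η / ε
        = ε * (η * α ^ 2 + 2 * α * (η * b') + η * b' ^ 2) + η * h ^ 2 / (4 * ε)
          - η / ε * (B + h / 2 + ε * (α + b')) ^ 2 := by
        field_simp; ring
      rw [h3]
      have h4 : 0 ≤ η / ε * (B + h / 2 + ε * (α + b')) ^ 2 := by positivity
      have := mul_le_mul_of_nonneg_left h2 hε.le
      nlinarith
  have hsq : η * h ^ 2 / (4 * ε) ≤ lam ^ 2 * (η * e) := by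
    have : η * h ^ 2 / (4 * ε) = lam ^ 2 * (η * (ε⁻¹ * w / 2)) := by
      rw [hh, mul_pow, hS]; field_simp; ring
    rw [this]
    have hw' : 0 ≤ ε⁻¹ * w := by positivity
    have : ε⁻¹ * w / 2 ≤ e := by
      rw [he]; have : 0 ≤ ε / 2 * V := by positivity
      linarith
    gcongr
  have hgg : g = (B + h) / ε := by rw [← hg]; field_simp
  have eqn : q * η * ((dd - 1) / (2 * r) - N / (4 * r ^ 2)) * e
      + q * η * (ε * Y + ε⁻¹ * Wp * g)
      - (ε * (q * η) * Y + ε * g * (q * (-(η / (2 * r)) * a + β)) + ε * g * (q * η) * Lf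
        + ε * (q * ((η / (4 * r ^ 2)) * a ^ 2 - a * β / r - η * V / (2 * r) + γ))
        + (q * (-(η / (2 * r)) * a + β)) * (ε * Lf - ε⁻¹ * Wp)
        - e * (q * (η * N / (4 * r ^ 2) - dd * η / (2 * r) - ζ / r + L)))
     = q * (-(2 * B + h) * (η * α + β) - (B ^ 2 + h * B) * η / ε)
       + q * (e * (-η / (2 * r) - ζ / r + L)
         - ε * (η * α ^ 2 + 2 * α * β - η * V / (2 * r) + γ)) := by
    have hLf : Lf = (B + ε⁻¹ * Wp) / ε := by rw [hB]; field_simp; ring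
    rw [hgg, hLf, hα]
    field_simp
    ring
  rw [eqn]
  have f1 : ε * V * η / (2 * r) ≤ e * η / (2 * r) := by gcongr
  have f2 : -(e * ζ / r) ≤ e * K / r := by
    rw [← neg_div, ← mul_neg]; gcongr; exact (neg_le_abs _).trans hζ
  have f3 : e * L ≤ e * K := by gcongr; exact (le_abs_self _).trans hL
  have f5 : ε * (K * V) ≤ e * K := by
    have h1 := mul_le_mul_of_nonneg_left hVe hK
    have h2 : ε * (K * V) = K * (ε * V) := by ring
    rw [h2, mul_comm e K]; exact h1
  have f4 : -(ε * γ) ≤ e * K := by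
    have : -γ ≤ K * V := (neg_le_abs _).trans hγ
    have h1 := mul_le_mul_of_nonneg_left this hε.le
    have h2 : ε * (-γ) = -(ε * γ) := by ring
    linarith
  have main : (-(2 * B + h) * (η * α + β) - (B ^ 2 + h * B) * η / ε)
       + (e * (-η / (2 * r) - ζ / r + L)
         - ε * (η * α ^ 2 + 2 * α * β - η * V / (2 * r) + γ))
      ≤ lam ^ 2 * (η * e) + (3 * K + K / r) * e := by
    have g1 : e * (-η / (2 * r) - ζ / r + L) = -(e * η / (2 * r)) + -(e * ζ / r) + e * L := by ring
    have g2 : ε * (η * α ^ 2 + 2 * α * β - η * V / (2 * r) + γ) =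
      ε * (η * α ^ 2 + 2 * α * β) - ε * V * η / (2 * r) + ε * γ := by ring
    have g3 : (3 * K + K / r) * e = e * K + e * K + e * K + e * K / r := by ring
    rw [g1, g2, g3]
    have g4 : ε * (η * α ^ 2 + 2 * α * β + K * V) = ε * (η * α ^ 2 + 2 * α * β) + ε * (K * V) := by
      ring
    rw [g4] at sq
    linarith
  have := mul_le_mul_of_nonneg_left main hq
  linarith

lemma exp_bound (d : ℕ) (hd : 2 ≤ d) (K : ℝ) (hK : 0 ≤ K) : ∃ c > 0, ∀ r > 0,
    (4 * Real.pi * r) ^ (-(((d : ℝ) - 1) / 2)) * Real.exp (-1 / (64 * r)) * (3 * K + K / r)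
      ≤ c * Real.exp (-1 / (128 * r)) := by
  have pw : ∀ m : ℕ, ∃ C ≥ 0, ∀ u : ℝ, 0 ≤ u → u ^ m ≤ C * Real.exp (u / 128) := by
    intro m
    refine ⟨m.factorial * 128 ^ m, by positivity, fun u hu => ?_⟩
    have := Real.pow_div_factorial_le_exp (x := u / 128) (by positivity) m
    rw [div_le_iff₀ (by positivity), div_pow, div_le_iff₀ (by positivity)] at this
    linarith
  obtain ⟨C1, hC1, h1⟩ := pw 1
  obtain ⟨C2, hC2, h2⟩ := pw d
  obtain ⟨C3, hC3, h3⟩ := pw (d + 1)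
  refine ⟨K * (3 + C1 + 3 * C2 + C3) + 1, by positivity, fun r hr => ?_⟩
  set u := r⁻¹ with hu
  have hu0 : 0 < u := by positivity
  have hP : (4 * Real.pi * r) ^ (-(((d : ℝ) - 1) / 2)) ≤ 1 + u ^ d := by
    rw [Real.rpow_neg (by positivity), ← Real.inv_rpow (by positivity)]
    have hdr : (2 : ℝ) ≤ d := by exact_mod_cast hd
    have hb : (4 * Real.pi * r)⁻¹ ≤ u := by
      rw [hu]
      apply inv_anti₀ hr
      nlinarith [Real.pi_gt_three]
    calc ((4 * Real.pi * r)⁻¹) ^ (((d : ℝ) - 1) / 2) ≤ u ^ (((d : ℝ) - 1) / 2) :=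
          Real.rpow_le_rpow (by positivity) hb (by linarith)
      _ ≤ 1 + u ^ d := by
          rcases le_total u 1 with h | h
          · have := Real.rpow_le_one hu0.le h (z := ((d : ℝ) - 1) / 2) (by linarith)
            have : 0 ≤ u ^ d := by positivity
            linarith
          · have := Real.rpow_le_rpow_of_exponent_le h (y := ((d : ℝ) - 1) / 2) (z := d) (by linarith)
            rw [Real.rpow_natCast] at this
            linarith
  have e1 : Real.exp (-1 / (64 * r)) = Real.exp (-1 / (128 * r)) * Real.exp (-(u / 128)) := by
    rw [← Real.exp_add, hu]; congr 1; field_simp; norm_num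
  have e2 : K / r = K * u := by rw [hu]; ring
  rw [e1, e2]
  have e3 : (1 + u ^ d) * (3 * K + K * u) ≤ (K * (3 + C1 + 3 * C2 + C3) + 1) * Real.exp (u / 128) := by
    have h0 : 1 ≤ Real.exp (u / 128) := Real.one_le_exp (by positivity)
    have i1 := h1 u hu0.le
    have i2 := h2 u hu0.le
    have i3 := h3 u hu0.le
    have : (3 + u ^ 1 + 3 * u ^ d + u ^ (d + 1)) ≤ (3 + C1 + 3 * C2 + C3) * Real.exp (u / 128) := by
      linarith
    have := mul_le_mul_of_nonneg_left this hK
    have t : (1 + u ^ d) * (3 * K + K * u) = K * (3 + u ^ 1 + 3 * u ^ d + u ^ (d + 1)) := by ring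
    rw [t, add_mul]
    linarith
  have e4 : (1 + u ^ d) * (3 * K + K * u) * Real.exp (-(u / 128)) ≤ K * (3 + C1 + 3 * C2 + C3) + 1 := by
    rw [Real.exp_neg, ← div_eq_mul_inv, div_le_iff₀ (Real.exp_pos _)]; exact e3
  calc _ ≤ (1 + u ^ d) * (Real.exp (-1 / (128 * r)) * Real.exp (-(u / 128))) * (3 * K + K * u) := by
        gcongr
    _ = ((1 + u ^ d) * (3 * K + K * u) * Real.exp (-(u / 128))) * Real.exp (-1 / (128 * r)) := by ring
    _ ≤ _ := by gcongr

lemma sq_deriv_bound (f f' f'' : ℝ → ℝ) (M : ℝ) (h1 : ∀ x, HasDerivAt f (f' x) x)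
    (h2 : ∀ x, HasDerivAt f' (f'' x) x) (hpos : ∀ x, 0 ≤ f x) (hb : ∀ x, f'' x ≤ M) :
    f' 0 ^ 2 ≤ 2 * M * f 0 := by
  -- k = f 0 + f' 0 x + M x^2/2 - f x is nonneg
  have hcv : ConvexOn ℝ univ (fun x => M * x ^ 2 / 2 - f x) := by
    have hd1 : ∀ x, HasDerivAt (fun x => M * x ^ 2 / 2 - f x) (M * x - f' x) x := fun x => by
      have := ((((hasDerivAt_id x).pow 2).const_mul M).div_const 2).sub (h1 x)
      refine this.congr_deriv ?_
      simp; ring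
    have hd2 : ∀ x, HasDerivAt (fun x => M * x - f' x) (M - f'' x) x := fun x => by
      have := ((hasDerivAt_id x).const_mul M).sub (h2 x)
      refine this.congr_deriv ?_
      simp
    have e1 : deriv (fun x => M * x ^ 2 / 2 - f x) = fun x => M * x - f' x :=
      funext fun x => (hd1 x).deriv
    refine MonotoneOn.convexOn_of_deriv convex_univ
      (fun x _ => (hd1 x).continuousAt.continuousWithinAt)
      (fun x _ => (hd1 x).differentiableAt.differentiableWithinAt) ?_
    rw [e1]
    refine (monotone_of_deriv_nonneg (fun x => (hd2 x).differentiableAt) fun x => ?_).monotoneOn _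
    rw [(hd2 x).deriv]; linarith [hb x]
  have tay : ∀ x, f x ≤ f 0 + f' 0 * x + M * x ^ 2 / 2 := by
    intro x
    have hd0 : HasDerivAt (fun x => M * x ^ 2 / 2 - f x) (- f' 0) 0 := by
      have := ((((hasDerivAt_id (0:ℝ)).pow 2).const_mul M).div_const 2).sub (h1 0)
      refine this.congr_deriv ?_
      simp
    rcases lt_trichotomy x 0 with h | h | h
    · have := hcv.slope_le_of_hasDerivAt (mem_univ x) (mem_univ 0) h hd0
      rw [slope_def_field, div_le_iff₀ (by linarith)] at this
      simp at this
      linarith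
    · rw [h]; simp
    · have := hcv.le_slope_of_hasDerivAt (mem_univ 0) (mem_univ x) h hd0
      rw [slope_def_field, le_div_iff₀ (by linarith)] at this
      simp at this
      linarith
  have hq : ∀ x, 0 ≤ (M / 2) * (x * x) + f' 0 * x + f 0 := fun x => by
    have := tay x; have := hpos x; nlinarith
  have := discrim_le_zero hq
  unfold discrim at this
  linarith

lemma eta_bounds {d : ℕ} (η : Ed d → ℝ) (hη : ContDiff ℝ (⊤ : ℕ∞) η) (hc : HasCompactSupport η)
    (hpos : ∀ x, 0 ≤ η x) : ∃ K ≥ 0, ∀ z : Ed d, |lap η z| ≤ K ∧ |∑ i, z i * pd i η z| ≤ K ∧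
      ∀ v : Fin d → ℝ, |∑ i, ∑ j, pd i (pd j η) z * (v i * v j)| ≤ K * ∑ i, v i * v i ∧
        (∑ i, pd i η z * v i) ^ 2 ≤ K * η z * ∑ i, v i * v i := by
  have c1 : ∀ i, HasCompactSupport (pd i η) := fun i => hc.fderiv_apply (𝕜 := ℝ) _
  have c2 : ∀ i j, HasCompactSupport (pd i (pd j η)) := fun i j => (c1 j).fderiv_apply (𝕜 := ℝ) _
  have b2 : ∀ i j, ∃ C, ∀ x, ‖pd i (pd j η) x‖ ≤ C := fun i j =>
    (c2 i j).exists_bound_of_continuous (pd_smooth i (pd_smooth j hη)).continuous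
  choose C hC using b2
  have b1 : ∀ i, ∃ C, ∀ x : Ed d, ‖x i * pd i η x‖ ≤ C := fun i => by
    refine HasCompactSupport.exists_bound_of_continuous (HasCompactSupport.mul_left (c1 i)) ?_
    have := (pd_smooth i hη).continuous
    fun_prop
  choose D hD using b1
  have hC0 : ∀ i j, 0 ≤ C i j := fun i j => (norm_nonneg _).trans (hC i j 0)
  have hD0 : ∀ i, 0 ≤ D i := fun i => (norm_nonneg _).trans (hD i 0)
  have sC : 0 ≤ ∑ i, ∑ j, C i j := Finset.sum_nonneg fun i _ => Finset.sum_nonneg fun j _ => hC0 i j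
  have sC2 : 0 ≤ ∑ i, C i i := Finset.sum_nonneg fun i _ => hC0 i i
  have sD : 0 ≤ ∑ i, D i := Finset.sum_nonneg fun i _ => hD0 i
  have grad : ∀ i z, pd i η z ^ 2 ≤ 2 * C i i * η z := by
    intro i z
    have hl : ∀ h : ℝ, HasDerivAt (fun h : ℝ => z + h • ebasis d i) (ebasis d i) h := fun h => by
      have := ((hasDerivAt_id h).smul_const (ebasis d i)).const_add z
      simpa using this
    have := sq_deriv_bound (fun h => η (z + h • ebasis d i)) (fun h => pd i η (z + h • ebasis d i))
      (fun h => pd i (pd i η) (z + h • ebasis d i)) (C i i)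
      (fun h => (sm_diff hη _).hasFDerivAt.comp_hasDerivAt h (hl h))
      (fun h => (sm_diff (pd_smooth i hη) _).hasFDerivAt.comp_hasDerivAt h (hl h))
      (fun h => hpos _) (fun h => (le_abs_self _).trans (hC i i _))
    simpa using this
  refine ⟨∑ i, ∑ j, C i j + ∑ i, D i + 2 * ∑ i, C i i, by positivity, fun z => ⟨?_, ?_, fun v => ?_⟩⟩
  · rw [lap_eq]
    calc _ ≤ ∑ i, |pd i (pd i η) z| := Finset.abs_sum_le_sum_abs _ _
      _ ≤ ∑ i, C i i := Finset.sum_le_sum fun i _ => hC i i z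
      _ ≤ _ := by linarith
  · calc _ ≤ ∑ i, |z i * pd i η z| := Finset.abs_sum_le_sum_abs _ _
      _ ≤ ∑ i, D i := Finset.sum_le_sum fun i _ => hD i z
      _ ≤ _ := by linarith
  · have hV : ∀ i, v i * v i ≤ ∑ i, v i * v i := fun i =>
      Finset.single_le_sum (f := fun i => v i * v i) (fun i _ => mul_self_nonneg _) (Finset.mem_univ i)
    have hV0 : 0 ≤ ∑ i, v i * v i := Finset.sum_nonneg fun i _ => mul_self_nonneg _
    constructor
    · calc _ ≤ ∑ i, ∑ j, |pd i (pd j η) z * (v i * v j)| :=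
            (Finset.abs_sum_le_sum_abs _ _).trans
              (Finset.sum_le_sum fun i _ => Finset.abs_sum_le_sum_abs _ _)
        _ ≤ ∑ i, ∑ j, C i j * ∑ i, v i * v i := by
            refine Finset.sum_le_sum fun i _ => Finset.sum_le_sum fun j _ => ?_
            rw [abs_mul]
            refine mul_le_mul (hC i j z) ?_ (abs_nonneg _) (hC0 i j)
            have h1 := hV i
            have h2 := hV j
            rw [abs_le]; constructor <;> nlinarith [sq_nonneg (v i - v j), sq_nonneg (v i + v j)]
        _ = (∑ i, ∑ j, C i j) * ∑ i, v i * v i := by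
            simp only [← Finset.sum_mul]
        _ ≤ _ := by gcongr; linarith
    · calc _ ≤ (∑ i, pd i η z ^ 2) * (∑ i, v i ^ 2) := Finset.sum_mul_sq_le_sq_mul_sq _ _ _
        _ ≤ (∑ i, 2 * C i i * η z) * (∑ i, v i ^ 2) := by
            gcongr with i _
            · exact grad i z
        _ = (2 * ∑ i, C i i) * η z * ∑ i, v i * v i := by
            simp only [← Finset.sum_mul, ← Finset.mul_sum, pow_two]
        _ ≤ _ := by
            have := hpos z
            gcongr; linarith

/-- Gaussian factor -/
def gk {d : ℕ} (P r : ℝ) (y x : Ed d) : ℝ := P * Real.exp (-‖x - y‖ ^ 2 / (4 * r))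

/-- localized kernel at a fixed time -/
def RR {d : ℕ} (η : Ed d → ℝ) (P r : ℝ) (y x : Ed d) : ℝ := gk P r y x * η (x - y)

lemma gk_smooth {d : ℕ} (P r : ℝ) (y : Ed d) : ContDiff ℝ (⊤ : ℕ∞) (gk P r y) := by
  unfold gk
  have : ContDiff ℝ (⊤ : ℕ∞) (fun x : Ed d => ‖x - y‖ ^ 2) :=
    (contDiff_id.sub contDiff_const).norm_sq ℝ
  fun_prop

lemma RR_smooth {d : ℕ} {η : Ed d → ℝ} (hη : ContDiff ℝ (⊤ : ℕ∞) η) (P r : ℝ) (y : Ed d) :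
    ContDiff ℝ (⊤ : ℕ∞) (RR η P r y) := by
  unfold RR
  exact (gk_smooth P r y).mul (hη.comp (contDiff_id.sub contDiff_const))

lemma pd_shift {d : ℕ} (i : Fin d) (f : Ed d → ℝ) (y x : Ed d) :
    pd i (fun x => f (x - y)) x = pd i f (x - y) := by
  unfold pd; rw [fderiv_comp_sub]

lemma pd_coord {d : ℕ} (i j : Fin d) (y x : Ed d) :
    pd i (fun x : Ed d => x j - y j) x = if i = j then 1 else 0 := by
  unfold pd
  have h : HasFDerivAt (fun x : Ed d => x j - y j) (EuclideanSpace.proj j : Ed d →L[ℝ] ℝ) x :=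
    (EuclideanSpace.proj j : Ed d →L[ℝ] ℝ).hasFDerivAt.sub_const _
  rw [h.fderiv]
  simp [ebasis, eq_comm]

lemma pd_gk {d : ℕ} (i : Fin d) (P r : ℝ) (y x : Ed d) :
    pd i (gk P r y) x = gk P r y x * (-(2 * r)⁻¹ * (x i - y i)) := by
  have h1 : HasFDerivAt (fun x : Ed d => ‖x - y‖ ^ 2) (2 • (innerSL ℝ (x - y))) x := by
    have := ((hasFDerivAt_id x).sub_const y).norm_sq
    simpa using this
  have h2 : DifferentiableAt ℝ (fun x : Ed d => ‖x - y‖ ^ 2) x := h1.differentiableAt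
  have h3 : pd i (fun x : Ed d => ‖x - y‖ ^ 2) x = 2 * (x i - y i) := by
    unfold pd; rw [h1.fderiv]
    simp [ebasis, EuclideanSpace.inner_single_right]
  unfold gk
  have h4 : HasDerivAt (fun u : ℝ => P * Real.exp (-u / (4 * r)))
      (P * (Real.exp (-(‖x - y‖ ^ 2) / (4 * r)) * (-1 / (4 * r)))) (‖x - y‖ ^ 2) := by
    have := (((hasDerivAt_id (‖x - y‖ ^ 2)).neg.div_const (4 * r)).exp).const_mul P
    simpa using this
  rw [pd_comp i h4 h2, h3]
  rw [mul_inv]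
  ring

lemma pd_RR {d : ℕ} {η : Ed d → ℝ} (hη : ContDiff ℝ (⊤ : ℕ∞) η) (i : Fin d) (P r : ℝ) (y x : Ed d) :
    pd i (RR η P r y) x =
      gk P r y x * (-(2 * r)⁻¹ * (x i - y i) * η (x - y) + pd i η (x - y)) := by
  unfold RR
  have h : DifferentiableAt ℝ (fun x => η (x - y)) x :=
    sm_diff (hη.comp (contDiff_id.sub contDiff_const)) x
  rw [pd_mul i (sm_diff (gk_smooth P r y) x) h, pd_gk, pd_shift]
  ring

lemma pd_pd_RR {d : ℕ} {η : Ed d → ℝ} (hη : ContDiff ℝ (⊤ : ℕ∞) η) (i j : Fin d) (P r : ℝ)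
    (y x : Ed d) :
    pd i (pd j (RR η P r y)) x =
      gk P r y x * ((2 * r)⁻¹ ^ 2 * η (x - y) * ((x i - y i) * (x j - y j))
        - (2 * r)⁻¹ * ((x i - y i) * pd j η (x - y)) - (2 * r)⁻¹ * ((x j - y j) * pd i η (x - y))
        - (2 * r)⁻¹ * η (x - y) * (if i = j then 1 else 0) + pd i (pd j η) (x - y)) := by
  rw [funext (pd_RR hη j P r y)]
  have h : DifferentiableAt ℝ (fun x => η (x - y)) x :=
    sm_diff (hη.comp (contDiff_id.sub contDiff_const)) x
  have h' : DifferentiableAt ℝ (fun x => pd j η (x - y)) x :=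
    sm_diff ((pd_smooth j hη).comp (contDiff_id.sub contDiff_const)) x
  have h0 : DifferentiableAt ℝ (fun x : Ed d => x j - y j) x := by fun_prop
  have h1 := h0.const_mul (-(2 * r)⁻¹)
  rw [pd_mul i (sm_diff (gk_smooth P r y) x) ((h1.fun_mul h).fun_add h'), pd_gk,
    pd_add i (h1.fun_mul h) h', pd_mul i h1 h, pd_const_mul i _ h0, pd_coord,
    pd_shift, pd_shift]
  ring

lemma contr1 {d : ℕ} {η : Ed d → ℝ} (hη : ContDiff ℝ (⊤ : ℕ∞) η) (P r : ℝ)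
    (y x : Ed d) (v : Fin d → ℝ) :
    ∑ i, pd i (RR η P r y) x * v i = gk P r y x * (-(η (x - y) / (2 * r)) *
      (∑ i, (x i - y i) * v i) + ∑ i, pd i η (x - y) * v i) := by
  simp_rw [pd_RR hη]
  rw [Finset.mul_sum, ← Finset.sum_add_distrib, Finset.mul_sum]
  refine Finset.sum_congr rfl fun i _ => ?_
  ring

lemma contr2 {d : ℕ} {η : Ed d → ℝ} (hη : ContDiff ℝ (⊤ : ℕ∞) η) (P r : ℝ)
    (y x : Ed d) (v : Fin d → ℝ) :
    ∑ i, ∑ j, pd i (pd j (RR η P r y)) x * (v i * v j) = gk P r y x *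
      ((η (x - y) / (4 * r ^ 2)) * (∑ i, (x i - y i) * v i) ^ 2
        - (∑ i, (x i - y i) * v i) * (∑ i, pd i η (x - y) * v i) / r
        - η (x - y) * (∑ i, v i * v i) / (2 * r)
        + ∑ i, ∑ j, pd i (pd j η) (x - y) * (v i * v j)) := by
  have e1 : (∑ i, (x i - y i) * v i) ^ 2 = ∑ i, ∑ j, ((x i - y i) * v i) * ((x j - y j) * v j) := by
    rw [pow_two, Finset.sum_mul_sum]
  have e2 : (∑ i, (x i - y i) * v i) * (∑ i, pd i η (x - y) * v i) =
      ∑ i, ∑ j, ((x i - y i) * v i) * (pd j η (x - y) * v j) := by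
    rw [Finset.sum_mul_sum]
  have e3 : (∑ i, (x i - y i) * v i) * (∑ i, pd i η (x - y) * v i) =
      ∑ i, ∑ j, ((x j - y j) * v j) * (pd i η (x - y) * v i) := by
    rw [Finset.sum_mul_sum, Finset.sum_comm]
  have e4 : ∑ i, v i * v i = ∑ i, ∑ j, (if i = j then 1 else 0) * (v i * v j) := by
    simp
  have e5 : (∑ i, (x i - y i) * v i) * (∑ i, pd i η (x - y) * v i) / r
    = (2 * r)⁻¹ * (∑ i, ∑ j, ((x i - y i) * v i) * (pd j η (x - y) * v j))
    + (2 * r)⁻¹ * ∑ i, ∑ j, ((x j - y j) * v j) * (pd i η (x - y) * v i) := by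
    rw [← e2, ← e3, mul_inv]; ring
  rw [e5, e1, e4]
  simp only [Finset.mul_sum, ← Finset.sum_add_distrib, ← Finset.sum_sub_distrib, Finset.sum_div]
  refine Finset.sum_congr rfl fun i _ => Finset.sum_congr rfl fun j _ => ?_
  rw [pd_pd_RR hη, mul_inv]
  ring

lemma contr3 {d : ℕ} {η : Ed d → ℝ} (hη : ContDiff ℝ (⊤ : ℕ∞) η) (P r : ℝ)
    (y x : Ed d) :
    lap (RR η P r y) x = gk P r y x *
      (η (x - y) * ‖x - y‖ ^ 2 / (4 * r ^ 2) - d * η (x - y) / (2 * r)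
        - (∑ i, (x - y) i * pd i η (x - y)) / r + lap η (x - y)) := by
  have e1 : ‖x - y‖ ^ 2 = ∑ i, (x i - y i) * (x i - y i) := by
    rw [EuclideanSpace.real_norm_sq_eq]; simp [pow_two]
  have e2 : (d : ℝ) = ∑ i : Fin d, 1 := by simp
  rw [e1, e2]
  simp only [lap_eq, Finset.mul_sum, ← Finset.sum_add_distrib, ← Finset.sum_sub_distrib,
    Finset.sum_div, Finset.sum_mul]
  refine Finset.sum_congr rfl fun i _ => ?_
  rw [pd_pd_RR hη, mul_inv]
  simp only [PiLp.sub_apply, if_true]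
  ring

lemma eta_flat {d : ℕ} {η : Ed d → ℝ} {z : Ed d} {c : ℝ} (h : η =ᶠ[nhds z] fun _ => c) :
    (∀ i, pd i η z = 0) ∧ ∀ i j, pd i (pd j η) z = 0 := by
  have h1 : ∀ᶠ x in nhds z, ∀ i, pd i η x = 0 := by
    filter_upwards [h.eventually_nhds] with x hx i
    have hx' : η =ᶠ[nhds x] fun _ => c := hx
    unfold pd; rw [hx'.fderiv_eq]; simp
  refine ⟨h1.self_of_nhds, fun i j => ?_⟩
  have : pd j η =ᶠ[nhds z] fun _ => 0 := h1.mono fun x hx => hx j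
  have e := this.fderiv_eq (𝕜 := ℝ)
  unfold pd at e ⊢
  rw [e]; simp

lemma pointwise_ineq {d : ℕ} (η : Ed d → ℝ) (hη : ContDiff ℝ (⊤ : ℕ∞) η)
    (hsupp : tsupport η ⊆ Metric.ball (0 : Ed d) (1 / 2))
    (hone : ∀ x ∈ Metric.ball (0 : Ed d) (1 / 4), η x = 1)
    (hbd : ∀ x : Ed d, 0 ≤ η x) (K : ℝ) (hK : 0 ≤ K)
    (hKb : ∀ z : Ed d, |lap η z| ≤ K ∧ |∑ i, z i * pd i η z| ≤ K ∧
      ∀ v : Fin d → ℝ, |∑ i, ∑ j, pd i (pd j η) z * (v i * v j)| ≤ K * ∑ i, v i * v i ∧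
        (∑ i, pd i η z * v i) ^ 2 ≤ K * η z * ∑ i, v i * v i)
    (c : ℝ) (hc0 : 0 < c) (P r : ℝ) (hP : 0 ≤ P) (hr : 0 < r)
    (hc : P * Real.exp (-1 / (64 * r)) * (3 * K + K / r) ≤ c * Real.exp (-1 / (128 * r)))
    (ε lam : ℝ) (hε : 0 < ε) (f g : Ed d → ℝ) (hf : ContDiff ℝ (⊤ : ℕ∞) f)
    (hg : ContDiff ℝ (⊤ : ℕ∞) g) (y x : Ed d)
    (heq : ε * g x = ε * lap f x - ε⁻¹ * W' (f x) + lam * Real.sqrt (2 * W (f x)))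
    (hdisc : ε / 2 * (∑ i, pd i f x * pd i f x) ≤ ε⁻¹ * W (f x)) :
    RR η P r y x * (((d : ℝ) - 1) / (2 * r) - ‖x - y‖ ^ 2 / (4 * r ^ 2)) * en ε f x
      + RR η P r y x * (ε * (∑ i, pd i f x * pd i g x) + ε⁻¹ * W' (f x) * g x)
    ≤ ∑ i, pd i (XX ε f g (RR η P r y) i) x + lam ^ 2 * (RR η P r y x * en ε f x)
      + c * Real.exp (-1 / (128 * r)) * (Metric.ball y (1 / 2)).indicator (en ε f) x := by
  have hq : 0 ≤ gk P r y x := by unfold gk; positivity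
  have hV : 0 ≤ ∑ i, pd i f x * pd i f x := Finset.sum_nonneg fun i _ => mul_self_nonneg _
  have hw := W_nonneg (f x)
  have hS : Real.sqrt (2 * W (f x)) ^ 2 = 2 * W (f x) := Real.sq_sqrt (by positivity)
  have he : 0 ≤ en ε f x := by unfold en; positivity
  have key : ∀ k : ℝ, 0 ≤ k → |lap η (x - y)| ≤ k → |∑ i, (x - y) i * pd i η (x - y)| ≤ k →
      |∑ i, ∑ j, pd i (pd j η) (x - y) * (pd i f x * pd j f x)| ≤ k * ∑ i, pd i f x * pd i f x →
      (∑ i, pd i η (x - y) * pd i f x) ^ 2 ≤ k * η (x - y) * ∑ i, pd i f x * pd i f x →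
      RR η P r y x * (((d : ℝ) - 1) / (2 * r) - ‖x - y‖ ^ 2 / (4 * r ^ 2)) * en ε f x
      + RR η P r y x * (ε * (∑ i, pd i f x * pd i g x) + ε⁻¹ * W' (f x) * g x)
      ≤ ∑ i, pd i (XX ε f g (RR η P r y) i) x + lam ^ 2 * (RR η P r y x * en ε f x)
        + gk P r y x * (3 * k + k / r) * en ε f x := by
    intro k hk h1 h2 h3 h4
    have := alg_ineq (gk P r y x) (η (x - y)) r ε (∑ i, pd i f x * pd i f x) (W (f x))
      (∑ i, (x i - y i) * pd i f x) (∑ i, pd i η (x - y) * pd i f x)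
      (∑ i, ∑ j, pd i (pd j η) (x - y) * (pd i f x * pd j f x))
      (∑ i, (x - y) i * pd i η (x - y)) (lap η (x - y)) (‖x - y‖ ^ 2)
      (ε * lap f x - ε⁻¹ * W' (f x)) lam (Real.sqrt (2 * W (f x))) k (g x) d (lap f x) (W' (f x))
      (∑ i, pd i f x * pd i g x) hq (hbd _) hr hε hV hw hdisc hS rfl heq hk h1 h2 h3 h4
    rw [div_XX ε hf hg (RR_smooth hη P r y) x, contr1 hη P r y x (fun i => pd i f x),
      contr2 hη P r y x (fun i => pd i f x), contr3 hη P r y x]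
    have e1 : RR η P r y x = gk P r y x * η (x - y) := rfl
    have e2 : en ε f x = ε / 2 * (∑ i, pd i f x * pd i f x) + ε⁻¹ * W (f x) := rfl
    rw [e1, e2]
    linarith
  by_cases hA : ‖x - y‖ < 1 / 4 ∨ 1 / 2 ≤ ‖x - y‖
  · have hflat : ∃ c, η =ᶠ[nhds (x - y)] fun _ => c := by
      rcases hA with h | h
      · refine ⟨1, ?_⟩
        filter_upwards [Metric.isOpen_ball.mem_nhds (show x - y ∈ Metric.ball (0 : Ed d) (1 / 4) by
          simpa using h)] with z hz using hone z hz
      · refine ⟨0, ?_⟩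
        have : x - y ∉ tsupport η := fun hh => by
          have := hsupp hh; simp at this; linarith
        exact notMem_tsupport_iff_eventuallyEq.1 this
    obtain ⟨c', hc'⟩ := hflat
    obtain ⟨z1, z2⟩ := eta_flat hc'
    have := key 0 le_rfl (by simp [lap_eq, z2]) (by simp [z1]) (by simp [z2]) (by simp [z1])
    have h5 : 0 ≤ c * Real.exp (-1 / (128 * r)) * (Metric.ball y (1 / 2)).indicator (en ε f) x := by
      refine mul_nonneg (by positivity) (Set.indicator_apply_nonneg ?_)
      exact fun _ => he
    simp only [mul_zero, zero_div, add_zero, zero_mul] at this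
    linarith
  · push Not at hA
    obtain ⟨k1, k2, k3⟩ := hKb (x - y)
    obtain ⟨k4, k5⟩ := k3 (fun i => pd i f x)
    have := key K hK k1 k2 k4 k5
    have hmem : x ∈ Metric.ball y (1 / 2) := by simpa [dist_eq_norm] using hA.2
    rw [Set.indicator_of_mem hmem]
    have h6 : gk P r y x ≤ P * Real.exp (-1 / (64 * r)) := by
      unfold gk
      gcongr P * Real.exp ?_
      rw [div_le_div_iff₀ (by positivity) (by positivity)]
      have : (1 / 4 : ℝ) ^ 2 ≤ ‖x - y‖ ^ 2 := by gcongr; exact hA.1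
      nlinarith
    have h7 : gk P r y x * (3 * K + K / r) ≤ c * Real.exp (-1 / (128 * r)) := by
      refine le_trans ?_ hc
      gcongr
    have h8 := mul_le_mul_of_nonneg_right h7 he
    linarith

lemma RR_supp {d : ℕ} {η : Ed d → ℝ} 
    (hsupp : tsupport η ⊆ Metric.ball (0 : Ed d) (1 / 2)) (y : Ed d) {x : Ed d}
    (hx : x ∉ Metric.closedBall y (1 / 2)) : η (x - y) = 0 := by
  by_contra h
  have := hsupp (subset_tsupport η h)
  simp [dist_eq_norm] at this hx
  linarith

lemma integral_ineq {d : ℕ} (η : Ed d → ℝ) (hη : ContDiff ℝ (⊤ : ℕ∞) η)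
    (hsupp : tsupport η ⊆ Metric.ball (0 : Ed d) (1 / 2))
    (hone : ∀ x ∈ Metric.ball (0 : Ed d) (1 / 4), η x = 1)
    (hbd : ∀ x : Ed d, 0 ≤ η x) (K : ℝ) (hK : 0 ≤ K)
    (hKb : ∀ z : Ed d, |lap η z| ≤ K ∧ |∑ i, z i * pd i η z| ≤ K ∧
      ∀ v : Fin d → ℝ, |∑ i, ∑ j, pd i (pd j η) z * (v i * v j)| ≤ K * ∑ i, v i * v i ∧
        (∑ i, pd i η z * v i) ^ 2 ≤ K * η z * ∑ i, v i * v i)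
    (c : ℝ) (hc0 : 0 < c) (P r : ℝ) (hP : 0 ≤ P) (hr : 0 < r)
    (hc : P * Real.exp (-1 / (64 * r)) * (3 * K + K / r) ≤ c * Real.exp (-1 / (128 * r)))
    (ε lam : ℝ) (hε : 0 < ε) (f g : Ed d → ℝ) (hf : ContDiff ℝ (⊤ : ℕ∞) f)
    (hg : ContDiff ℝ (⊤ : ℕ∞) g) (y : Ed d)
    (heq : ∀ x, ε * g x = ε * lap f x - ε⁻¹ * W' (f x) + lam * Real.sqrt (2 * W (f x)))
    (hdisc : ∀ x, ε / 2 * (∑ i, pd i f x * pd i f x) ≤ ε⁻¹ * W (f x))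
    (hint : Integrable fun x =>
      RR η P r y x * (((d : ℝ) - 1) / (2 * r) - ‖x - y‖ ^ 2 / (4 * r ^ 2)) * en ε f x
      + RR η P r y x * (ε * (∑ i, pd i f x * pd i g x) + ε⁻¹ * W' (f x) * g x)) :
    ∫ x, (RR η P r y x * (((d : ℝ) - 1) / (2 * r) - ‖x - y‖ ^ 2 / (4 * r ^ 2)) * en ε f x
      + RR η P r y x * (ε * (∑ i, pd i f x * pd i g x) + ε⁻¹ * W' (f x) * g x))
    ≤ lam ^ 2 * (∫ x, RR η P r y x * en ε f x)
      + c * (Real.exp (-1 / (128 * r)) * ∫ x in Metric.ball y (1 / 2), en ε f x) := by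
  have hcs : HasCompactSupport (RR η P r y) :=
    HasCompactSupport.intro (isCompact_closedBall y (1 / 2)) fun x hx => by
      simp [RR, RR_supp hsupp y hx]
  have hRs := RR_smooth hη P r y
  have i1 : ∀ i, Integrable (pd i (XX ε f g (RR η P r y) i)) := fun i =>
    (int_pd i (XX_smooth ε hf hg hRs i) (XX_supp ε hcs i)).1
  have i2 : Integrable (fun x => RR η P r y x * en ε f x) :=
    (hRs.continuous.mul (en_smooth ε hf).continuous).integrable_of_hasCompactSupport hcs.mul_right
  have i3 : Integrable ((Metric.ball y (1 / 2)).indicator (en ε f)) := by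
    rw [integrable_indicator_iff measurableSet_ball]
    exact ((en_smooth ε hf).continuous.continuousOn.integrableOn_compact
      (isCompact_closedBall y (1 / 2))).mono_set Metric.ball_subset_closedBall
  have i1' := integrable_finsetSum Finset.univ fun i _ => i1 i
  have i4 := (i1'.add (i2.const_mul (lam ^ 2))).add (i3.const_mul (c * Real.exp (-1 / (128 * r))))
  have := integral_mono hint i4 fun x => by
    have := pointwise_ineq η hη hsupp hone hbd K hK hKb c hc0 P r hP hr hc ε lam hε f g hf hg y x
      (heq x) (hdisc x)
    simpa using this
  refine this.trans (le_of_eq ?_)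
  have e0 : ∫ x, ((fun x => ∑ i, pd i (XX ε f g (RR η P r y) i) x) + (fun x => lam ^ 2 * (RR η P r y x * en ε f x))
     + fun x => c * Real.exp (-1 / (128 * r)) * (Metric.ball y (1 / 2)).indicator (en ε f) x) x = 
     (∫ x, ∑ i, pd i (XX ε f g (RR η P r y) i) x) + (∫ x, lam ^ 2 * (RR η P r y x * en ε f x))
     + ∫ x, c * Real.exp (-1 / (128 * r)) * (Metric.ball y (1 / 2)).indicator (en ε f) x := by
    rw [integral_add' (i1'.add (i2.const_mul (lam ^ 2))) (i3.const_mul _), integral_add' i1' (i2.const_mul _)]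
  refine e0.trans ?_
  rw [integral_finsetSum _ fun i _ => i1 i, integral_const_mul, integral_const_mul,
    integral_indicator measurableSet_ball]
  simp_rw [fun i => (int_pd i (XX_smooth ε hf hg hRs i) (XX_supp ε hcs i)).2]
  simp; ring

/-- space derivative of a space-time function -/
def DP {d : ℕ} (i : Fin d) (Φ : Ed d × ℝ → ℝ) (p : Ed d × ℝ) : ℝ := fderiv ℝ Φ p (ebasis d i, 0)

/-- time derivative of a space-time function -/
def DT {d : ℕ} (Φ : Ed d × ℝ → ℝ) (p : Ed d × ℝ) : ℝ := fderiv ℝ Φ p (0, 1)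

lemma DP_smooth {d : ℕ} (i : Fin d) {Φ : Ed d × ℝ → ℝ} (h : ContDiff ℝ (⊤ : ℕ∞) Φ) :
    ContDiff ℝ (⊤ : ℕ∞) (DP i Φ) := by
  unfold DP
  exact (h.fderiv_right (m := (⊤ : ℕ∞)) (by simp)).clm_apply contDiff_const

lemma DT_smooth {d : ℕ} {Φ : Ed d × ℝ → ℝ} (h : ContDiff ℝ (⊤ : ℕ∞) Φ) :
    ContDiff ℝ (⊤ : ℕ∞) (DT Φ) := by
  unfold DT
  exact (h.fderiv_right (m := (⊤ : ℕ∞)) (by simp)).clm_apply contDiff_const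

lemma slice_smooth {d : ℕ} {Φ : Ed d × ℝ → ℝ} (h : ContDiff ℝ (⊤ : ℕ∞) Φ) (t : ℝ) :
    ContDiff ℝ (⊤ : ℕ∞) (fun x => Φ (x, t)) :=
  h.comp (contDiff_id.prodMk contDiff_const)

lemma pd_slice {d : ℕ} (i : Fin d) {Φ : Ed d × ℝ → ℝ} (h : ContDiff ℝ (⊤ : ℕ∞) Φ) (x : Ed d) (t : ℝ) :
    pd i (fun x => Φ (x, t)) x = DP i Φ (x, t) := by
  have := HasFDerivAt.comp x (f := fun e : Ed d => (e, t)) (sm_diff h (x, t)).hasFDerivAt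
    (hasFDerivAt_prodMk_left (𝕜 := ℝ) x t)
  unfold pd DP
  have e := this.fderiv
  simp only [Function.comp_def] at e
  rw [e]; simp

lemma DT_slice {d : ℕ} {Φ : Ed d × ℝ → ℝ} (h : ContDiff ℝ (⊤ : ℕ∞) Φ) (x : Ed d) (t : ℝ) :
    HasDerivAt (fun t => Φ (x, t)) (DT Φ (x, t)) t := by
  have := (HasFDerivAt.comp t (f := fun e : ℝ => (x, e)) (sm_diff h (x, t)).hasFDerivAt
    (hasFDerivAt_prodMk_right (𝕜 := ℝ) x t)).hasDerivAt
  simpa [DT, Function.comp_def] using this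

/-- space-time energy density -/
def EE {d : ℕ} (ε : ℝ) (Φ : Ed d × ℝ → ℝ) (p : Ed d × ℝ) : ℝ :=
  ε / 2 * (∑ j, DP j Φ p * DP j Φ p) + ε⁻¹ * W (Φ p)

/-- its time derivative -/
def ET {d : ℕ} (ε : ℝ) (Φ : Ed d × ℝ → ℝ) (p : Ed d × ℝ) : ℝ :=
  ε * (∑ j, DP j Φ p * DP j (DT Φ) p) + ε⁻¹ * W' (Φ p) * DT Φ p

lemma EE_cont {d : ℕ} (ε : ℝ) {Φ : Ed d × ℝ → ℝ} (h : ContDiff ℝ (⊤ : ℕ∞) Φ) :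
    Continuous (EE ε Φ) := by
  have h1 := fun j => (DP_smooth j h).continuous
  have h2 : Continuous fun p => W (Φ p) := W_smooth.continuous.comp h.continuous
  unfold EE; fun_prop

lemma ET_cont {d : ℕ} (ε : ℝ) {Φ : Ed d × ℝ → ℝ} (h : ContDiff ℝ (⊤ : ℕ∞) Φ) :
    Continuous (ET ε Φ) := by
  have h1 := fun j => (DP_smooth j h).continuous
  have h3 := fun j => (DP_smooth j (DT_smooth h)).continuous
  have h4 := (DT_smooth h).continuous
  have h5 := h.continuous
  have h2 : Continuous fun p => W' (Φ p) := by unfold W'; fun_prop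
  unfold ET; fun_prop

lemma en_slice {d : ℕ} (ε : ℝ) {Φ : Ed d × ℝ → ℝ} (h : ContDiff ℝ (⊤ : ℕ∞) Φ) (x : Ed d) (t : ℝ) :
    en ε (fun x => Φ (x, t)) x = EE ε Φ (x, t) := by
  unfold en EE; simp_rw [fun j => pd_slice j h x t]

lemma EE_deriv {d : ℕ} (ε : ℝ) {Φ : Ed d × ℝ → ℝ} (h : ContDiff ℝ (⊤ : ℕ∞) Φ) (x : Ed d) (t : ℝ) :
    HasDerivAt (fun t => EE ε Φ (x, t)) (ET ε Φ (x, t)) t := by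
  have h1 : ∀ j, HasDerivAt (fun t => DP j Φ (x, t)) (DP j (DT Φ) (x, t)) t := fun j => by
    have := DT_slice (DP_smooth j h) x t
    refine this.congr_deriv ?_
    exact snd_symm h _ _ _
  have h2 := HasDerivAt.fun_sum (u := Finset.univ) fun j _ => (h1 j).fun_mul (h1 j)
  have h3 := (W_deriv (Φ (x, t))).comp t (DT_slice h x t)
  have h4 := (h2.const_mul (ε / 2)).fun_add (h3.const_mul ε⁻¹)
  unfold EE
  refine h4.congr_deriv ?_
  unfold ET
  simp only [Finset.mul_sum]
  congr 1
  · refine Finset.sum_congr rfl fun j _ => ?_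
    ring
  · ring

/-- prefactor -/
def PP (d : ℕ) (r : ℝ) : ℝ := (4 * Real.pi * r) ^ (-(((d : ℝ) - 1) / 2))

lemma rho_eq {d : ℕ} (η : Ed d → ℝ) (y : Ed d) (s : ℝ) (x : Ed d) (t : ℝ) :
    rhoTilde η y s x t = RR η (PP d (s - t)) (s - t) y x := rfl

lemma rho_deriv {d : ℕ} (η : Ed d → ℝ) (y : Ed d) (s : ℝ) (x : Ed d) (t : ℝ) (ht : t < s) :
    HasDerivAt (fun t => RR η (PP d (s - t)) (s - t) y x)
      (RR η (PP d (s - t)) (s - t) y x *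
        (((d : ℝ) - 1) / (2 * (s - t)) - ‖x - y‖ ^ 2 / (4 * (s - t) ^ 2))) t := by
  have hr : 0 < s - t := by linarith
  have h1 : HasDerivAt (fun t => s - t) (-1) t := by
    simpa using (hasDerivAt_id t).const_sub s
  have h2 : HasDerivAt (fun t => PP d (s - t)) (PP d (s - t) * (((d : ℝ) - 1) / (2 * (s - t)))) t := by
    unfold PP
    have h := (h1.const_mul (4 * Real.pi)).rpow_const (p := -(((d : ℝ) - 1) / 2))
      (Or.inl (by positivity))
    refine h.congr_deriv ?_
    rw [Real.rpow_sub_one (by positivity)]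
    field_simp
  have h3 : HasDerivAt (fun t => Real.exp (-‖x - y‖ ^ 2 / (4 * (s - t))))
      (Real.exp (-‖x - y‖ ^ 2 / (4 * (s - t))) * (-(‖x - y‖ ^ 2 / (4 * (s - t) ^ 2)))) t := by
    have h := ((hasDerivAt_const t (-‖x - y‖ ^ 2)).fun_div (h1.const_mul 4) (by positivity)).exp
    refine h.congr_deriv ?_
    congr 1
    field_simp
    ring
  unfold RR gk
  refine ((h2.fun_mul h3).mul_const (η (x - y))).congr_deriv ?_
  ring

lemma F_deriv {d : ℕ} (η : Ed d → ℝ) (hη : ContDiff ℝ (⊤ : ℕ∞) η)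
    (hsupp : tsupport η ⊆ Metric.ball (0 : Ed d) (1 / 2)) (y : Ed d) (s t : ℝ) (ht : t < s)
    (ε : ℝ) {Φ : Ed d × ℝ → ℝ} (h : ContDiff ℝ (⊤ : ℕ∞) Φ) :
    Integrable (fun x => RR η (PP d (s - t)) (s - t) y x *
        (((d : ℝ) - 1) / (2 * (s - t)) - ‖x - y‖ ^ 2 / (4 * (s - t) ^ 2)) * EE ε Φ (x, t)
        + RR η (PP d (s - t)) (s - t) y x * ET ε Φ (x, t)) ∧
    HasDerivAt (fun t => ∫ x, RR η (PP d (s - t)) (s - t) y x * EE ε Φ (x, t))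
      (∫ x, (RR η (PP d (s - t)) (s - t) y x *
        (((d : ℝ) - 1) / (2 * (s - t)) - ‖x - y‖ ^ 2 / (4 * (s - t) ^ 2)) * EE ε Φ (x, t)
        + RR η (PP d (s - t)) (s - t) y x * ET ε Φ (x, t))) t := by
  set δ := (s - t) / 2 with hδ
  have hδ0 : 0 < δ := by rw [hδ]; linarith
  set G : ℝ → Ed d → ℝ := fun t x => RR η (PP d (s - t)) (s - t) y x *
        (((d : ℝ) - 1) / (2 * (s - t)) - ‖x - y‖ ^ 2 / (4 * (s - t) ^ 2)) * EE ε Φ (x, t)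
        + RR η (PP d (s - t)) (s - t) y x * ET ε Φ (x, t) with hG
  have hEc := EE_cont ε h
  have hTc := ET_cont ε h
  have hηc := hη.continuous
  have hGc : ContinuousOn (fun p : ℝ × Ed d => G p.1 p.2) (Icc (t - δ) (t + δ) ×ˢ univ) := by
    have hne : ∀ p ∈ (Icc (t - δ) (t + δ) ×ˢ (univ : Set (Ed d))), s - p.1 ≠ 0 := by
      rintro ⟨a, b⟩ ⟨⟨_, h2⟩, _⟩
      simp only at h2 ⊢
      rw [hδ] at h2; linarith
    have c0 : ContinuousOn (fun p : ℝ × Ed d => s - p.1) (Icc (t - δ) (t + δ) ×ˢ univ) := by fun_prop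
    have c1 : ContinuousOn (fun p : ℝ × Ed d => PP d (s - p.1)) (Icc (t - δ) (t + δ) ×ˢ univ) := by
      unfold PP
      refine ContinuousOn.rpow_const (by fun_prop) fun p hp => Or.inl ?_
      have := hne p hp
      positivity
    have c2 : ContinuousOn (fun p : ℝ × Ed d => RR η (PP d (s - p.1)) (s - p.1) y p.2)
        (Icc (t - δ) (t + δ) ×ˢ univ) := by
      unfold RR gk
      refine (c1.mul (Real.continuous_exp.comp_continuousOn
        (ContinuousOn.div (by fun_prop) (by fun_prop) ?_))).mul ?_
      · intro p hp; exact mul_ne_zero (by norm_num) (hne p hp)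
      · exact (hηc.comp (continuous_snd.sub continuous_const)).continuousOn
    have c3 : ContinuousOn (fun p : ℝ × Ed d =>
        ((d : ℝ) - 1) / (2 * (s - p.1)) - ‖p.2 - y‖ ^ 2 / (4 * (s - p.1) ^ 2))
        (Icc (t - δ) (t + δ) ×ˢ univ) := by
      refine (ContinuousOn.div (by fun_prop) (by fun_prop) ?_).sub
        (ContinuousOn.div (by fun_prop) (by fun_prop) ?_)
      · intro p hp; exact mul_ne_zero (by norm_num) (hne p hp)
      · intro p hp; exact mul_ne_zero (by norm_num) (pow_ne_zero _ (hne p hp))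
    have c4 : Continuous (fun p : ℝ × Ed d => EE ε Φ (p.2, p.1)) :=
      hEc.comp (continuous_snd.prodMk continuous_fst)
    have c5 : Continuous (fun p : ℝ × Ed d => ET ε Φ (p.2, p.1)) :=
      hTc.comp (continuous_snd.prodMk continuous_fst)
    exact ((c2.mul c3).mul c4.continuousOn).add (c2.mul c5.continuousOn)
  have hG0 : ∀ t x, x ∉ Metric.closedBall y (1 / 2) → G t x = 0 := fun t x hx => by
    simp [hG, RR, RR_supp hsupp y hx]
  have hcpt : IsCompact (Icc (t - δ) (t + δ) ×ˢ Metric.closedBall y (1 / 2)) :=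
    isCompact_Icc.prod (isCompact_closedBall _ _)
  obtain ⟨M, hM⟩ := hcpt.exists_bound_of_continuousOn
    (hGc.mono (Set.prod_mono le_rfl (subset_univ _)))
  have hslice : ∀ t, Continuous (fun x => RR η (PP d (s - t)) (s - t) y x * EE ε Φ (x, t)) :=
    fun t => (RR_smooth hη _ _ y).continuous.mul (hEc.comp (continuous_id.prodMk continuous_const))
  refine hasDerivAt_integral_of_dominated_loc_of_deriv_le (μ := volume)
    (F := fun t x => RR η (PP d (s - t)) (s - t) y x * EE ε Φ (x, t)) (F' := G)
    (bound := (Metric.closedBall y (1 / 2)).indicator fun _ => M)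
    (s := Icc (t - δ) (t + δ)) (Icc_mem_nhds (by linarith) (by linarith)) ?_ ?_ ?_ ?_ ?_ ?_
  · exact Filter.Eventually.of_forall fun t => (hslice t).aestronglyMeasurable
  · refine (hslice t).integrable_of_hasCompactSupport
      (HasCompactSupport.intro (isCompact_closedBall y (1 / 2)) fun x hx => ?_)
    simp [RR, RR_supp hsupp y hx]
  · have : Continuous (G t) := by
      rw [← continuousOn_univ]
      exact hGc.comp (f := fun x => (t, x)) (by fun_prop)
        fun x _ => ⟨⟨by simp; linarith, by simp; linarith⟩, mem_univ _⟩
    exact this.aestronglyMeasurable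
  · refine Filter.Eventually.of_forall fun x t' ht' => ?_
    by_cases hx : x ∈ Metric.closedBall y (1 / 2)
    · rw [Set.indicator_of_mem hx]
      exact hM (t', x) ⟨ht', hx⟩
    · rw [hG0 _ _ hx, Set.indicator_of_notMem hx]; simp
  · rw [integrable_indicator_iff measurableSet_closedBall]
    exact integrableOn_const (isCompact_closedBall y (1 / 2)).measure_lt_top.ne
  · refine Filter.Eventually.of_forall fun x t' ht' => ?_
    have : t' < s := by have := ht'.2; rw [hδ] at this; linarith
    exact (rho_deriv η y s x t' this).fun_mul (EE_deriv ε h x t')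

lemma grad_norm {d : ℕ} (f : Ed d → ℝ) (x : Ed d) :
    ‖gradient f x‖ ^ 2 = ∑ i, pd i f x * pd i f x := by
  rw [EuclideanSpace.real_norm_sq_eq]
  refine Finset.sum_congr rfl fun i _ => ?_
  have : gradient f x i = pd i f x := by
    have h1 : inner ℝ (gradient f x) (ebasis d i) = pd i f x := by
      unfold gradient pd
      rw [InnerProductSpace.toDual_symm_apply]
    rw [← h1, ebasis, EuclideanSpace.inner_single_right]; simp
  rw [this, pow_two]

lemma dens_eq {d : ℕ} (ε : ℝ) (φ : Ed d → ℝ → ℝ)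
    (h : ContDiff ℝ (⊤ : ℕ∞) (fun p : Ed d × ℝ => φ p.1 p.2)) (x : Ed d) (t : ℝ) :
    dens ε φ x t = sig⁻¹ * EE ε (fun p : Ed d × ℝ => φ p.1 p.2) (x, t) := by
  rw [← en_slice ε h x t]
  unfold dens en
  rw [grad_norm]
  ring

lemma gronwall_int (F F' h lam : ℝ → ℝ) (t₁ t₂ : ℝ) (h1 : 0 ≤ t₁) (h12 : t₁ < t₂)
    (hlam : ContinuousOn lam (Set.Ici 0))
    (hF : ∀ t ∈ Icc t₁ t₂, HasDerivAt F (F' t) t)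
    (hh : ContinuousOn h (Icc t₁ t₂)) (hh0 : ∀ t ∈ Icc t₁ t₂, 0 ≤ h t)
    (hle : ∀ t ∈ Icc t₁ t₂, F' t ≤ (lam t) ^ 2 * F t + h t) :
    F t₂ ≤ (F t₁ + ∫ t in t₁..t₂, h t) * Real.exp (∫ t in t₁..t₂, (lam t) ^ 2) := by
  set l : ℝ → ℝ := fun t => (lam (max t 0)) ^ 2 with hl
  have hlc : Continuous l := by
    have : Continuous fun t : ℝ => lam (max t 0) :=
      hlam.comp_continuous (by fun_prop) fun t => mem_Ici.2 (le_max_right _ _)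
    exact this.pow 2
  have hll : ∀ t, t₁ ≤ t → l t = lam t ^ 2 := fun t ht => by
    simp only [hl]; rw [max_eq_left (h1.trans ht)]
  have hΛ : ∀ t, HasDerivAt (fun t => ∫ τ in t₁..t, l τ) (l t) t := fun t =>
    intervalIntegral.integral_hasDerivAt_right (hlc.intervalIntegrable _ _)
      (hlc.stronglyMeasurableAtFilter _ _) hlc.continuousAt
  have hG : ∀ t ∈ Icc t₁ t₂, HasDerivAt (fun t => F t * Real.exp (-∫ τ in t₁..t, l τ))
      (F' t * Real.exp (-∫ τ in t₁..t, l τ) + F t * (Real.exp (-∫ τ in t₁..t, l τ) * -l t)) t :=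
    fun t ht => (hF t ht).fun_mul (hΛ t).neg.exp
  have hi : ∫ t in t₁..t₂, (lam t) ^ 2 = ∫ t in t₁..t₂, l t :=
    intervalIntegral.integral_congr fun t ht => by
      rw [uIcc_of_le h12.le] at ht; exact (hll t ht.1).symm
  have key := intervalIntegral.sub_le_integral_of_hasDeriv_right_of_le (φ := h) h12.le
    (fun t ht => (hG t ht).continuousAt.continuousWithinAt)
    (fun t ht => (hG t (Ioo_subset_Icc_self ht)).hasDerivWithinAt)
    (hh.integrableOn_compact isCompact_Icc)
    (fun t ht => by
      have ht' := Ioo_subset_Icc_self ht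
      have a := hle t ht'
      rw [← hll t ht'.1] at a
      have hΛ0 : 0 ≤ ∫ τ in t₁..t, l τ :=
        intervalIntegral.integral_nonneg ht'.1 fun τ _ => by positivity
      have b : Real.exp (-∫ τ in t₁..t, l τ) ≤ 1 := Real.exp_le_one_iff.2 (by linarith)
      have b0 := Real.exp_pos (-∫ τ in t₁..t, l τ)
      have c1 := mul_le_mul_of_nonneg_right a b0.le
      have c2 := mul_le_mul_of_nonneg_left b (hh0 t ht')
      nlinarith)
  simp only [intervalIntegral.integral_same, neg_zero, Real.exp_zero, mul_one] at key
  rw [hi]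
  have e : F t₂ = F t₂ * Real.exp (-∫ τ in t₁..t₂, l τ) * Real.exp (∫ τ in t₁..t₂, l τ) := by
    rw [mul_assoc, ← Real.exp_add]; simp
  rw [e]
  gcongr
  linarith


/-- localized monotonicity formula. -/
theorem monotonicity_formula {d : ℕ} (hd : 2 ≤ d)
    (η : Ed d → ℝ) (hηsmooth : ContDiff ℝ (⊤ : ℕ∞) η)
    (hηradial : ∀ x y : Ed d, ‖x‖ = ‖y‖ → η x = η y)
    (hηsupp : tsupport η ⊆ Metric.ball (0 : Ed d) (1 / 2))
    (hηone : ∀ x ∈ Metric.ball (0 : Ed d) (1 / 4), η x = 1)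
    (hηbd : ∀ x : Ed d, η x ∈ Set.Icc (0 : ℝ) 1) :
    ∃ c₅ > (0 : ℝ), ∀ ε ∈ Set.Ioo (0 : ℝ) 1, ∀ lam : ℝ → ℝ, ContinuousOn lam (Set.Ici 0) →
      ∀ φ : Ed d → ℝ → ℝ,
        ContDiff ℝ (⊤ : ℕ∞) (fun p : Ed d × ℝ => φ p.1 p.2) →
        (∀ t, ZdPeriodic fun x => φ x t) →
        (∀ (x : Ed d) (t : ℝ), 0 ≤ t →
          ε * deriv (φ x) t =
            ε * lap (fun y => φ y t) x - W' (φ x t) / ε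
              + lam t * Real.sqrt (2 * W (φ x t))) →
        (∀ (x : Ed d) (t : ℝ), 0 ≤ t →
          ε * ‖gradient (fun y => φ y t) x‖ ^ 2 / 2 ≤ W (φ x t) / ε) →
        ∀ (y : Ed d) (s t₁ t₂ : ℝ), 0 ≤ t₁ → t₁ < t₂ → t₂ < s →
          (∫ x : Ed d, rhoTilde η y s x t₂ * dens ε φ x t₂)
            ≤ ((∫ x : Ed d, rhoTilde η y s x t₁ * dens ε φ x t₁)
                + c₅ * ∫ t in t₁..t₂, Real.exp (-1 / (128 * (s - t)))
                    * ∫ x in Metric.ball y (1 / 2), dens ε φ x t)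
              * Real.exp (∫ t in t₁..t₂, (lam t) ^ 2) := by
  have hcs : HasCompactSupport η := by
    refine HasCompactSupport.intro (isCompact_closedBall (0 : Ed d) (1 / 2)) fun x hx => ?_
    have := RR_supp hηsupp 0 hx
    simpa using this
  have hpos : ∀ x, 0 ≤ η x := fun x => (hηbd x).1
  obtain ⟨K, hK, hKb⟩ := eta_bounds η hηsmooth hcs hpos
  obtain ⟨c, hc0, hc⟩ := exp_bound d hd K hK
  refine ⟨c, hc0, ?_⟩
  intro ε hε lam hlam φ hφ _ heq hdisc y s t₁ t₂ h0 h12 h2s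
  have hε0 : 0 < ε := hε.1
  set Φ : Ed d × ℝ → ℝ := fun p => φ p.1 p.2 with hΦ
  have hd1 : ∀ x t, dens ε φ x t = sig⁻¹ * EE ε Φ (x, t) := dens_eq ε φ hφ
  have hEc := EE_cont ε hφ
  have hE0 : ∀ p, 0 ≤ EE ε Φ p := fun p => by
    unfold EE
    have := W_nonneg (Φ p)
    have : 0 ≤ ∑ j, DP j Φ p * DP j Φ p := Finset.sum_nonneg fun i _ => mul_self_nonneg _
    positivity
  haveI : Nontrivial (Ed d) := Module.nontrivial_of_finrank_pos (R := ℝ) (by simp; omega)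
  have hmu : Continuous fun t => ∫ x in Metric.ball y (1 / 2), EE ε Φ (x, t) := by
    have h1 : ∀ t, ∫ x in Metric.ball y (1 / 2), EE ε Φ (x, t) =
        ∫ x in Metric.closedBall y (1 / 2), EE ε Φ (x, t) := fun t => by
      refine setIntegral_congr_set ?_
      refine (ae_eq_of_subset_of_measure_ge Metric.ball_subset_closedBall ?_
        measurableSet_ball.nullMeasurableSet (isCompact_closedBall y (1 / 2)).measure_lt_top.ne)
      exact (Measure.addHaar_closedBall_eq_addHaar_ball volume y (1 / 2)).le
    simp_rw [h1]
    exact continuous_parametric_integral_of_continuous (f := fun t x => EE ε Φ (x, t))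
      (hEc.comp (continuous_snd.prodMk continuous_fst)) (isCompact_closedBall _ _)
  have gr := gronwall_int (fun t => ∫ x, RR η (PP d (s - t)) (s - t) y x * EE ε Φ (x, t))
    (fun t => ∫ x, (RR η (PP d (s - t)) (s - t) y x *
        (((d : ℝ) - 1) / (2 * (s - t)) - ‖x - y‖ ^ 2 / (4 * (s - t) ^ 2)) * EE ε Φ (x, t)
        + RR η (PP d (s - t)) (s - t) y x * ET ε Φ (x, t)))
    (fun t => c * (Real.exp (-1 / (128 * (s - t))) * ∫ x in Metric.ball y (1 / 2), EE ε Φ (x, t)))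
    lam t₁ t₂ h0 h12 hlam
    (fun t ht => (F_deriv η hηsmooth hηsupp y s t (by linarith [ht.2]) ε hφ).2)
    (by
      refine continuousOn_const.mul (ContinuousOn.mul ?_ hmu.continuousOn)
      refine Real.continuous_exp.comp_continuousOn (ContinuousOn.div (by fun_prop) (by fun_prop) ?_)
      intro t ht
      have : 0 < s - t := by linarith [ht.2]
      positivity)
    (fun t ht => mul_nonneg hc0.le (mul_nonneg (Real.exp_pos _).le
      (integral_nonneg fun x => hE0 _)))
    (fun t ht => by
      have hr : 0 < s - t := by linarith [ht.2]
      have ht0 : 0 ≤ t := h0.trans ht.1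
      have hint := (F_deriv η hηsmooth hηsupp y s t (by linarith [ht.2]) ε hφ).1
      have e1 : ∀ x, ET ε Φ (x, t) = ε * (∑ i, pd i (fun x => Φ (x, t)) x *
          pd i (fun x => DT Φ (x, t)) x) + ε⁻¹ * W' (Φ (x, t)) * DT Φ (x, t) := fun x => by
        unfold ET
        simp_rw [fun j => pd_slice j hφ x t, fun j => pd_slice j (DT_smooth hφ) x t]
      simp_rw [← en_slice ε hφ, e1] at hint ⊢
      refine integral_ineq η hηsmooth hηsupp hηone hpos K hK hKb c hc0 (PP d (s - t)) (s - t)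
        (by unfold PP; positivity) hr (hc _ hr) ε (lam t) hε0 (fun x => Φ (x, t))
        (fun x => DT Φ (x, t)) (slice_smooth hφ t) (slice_smooth (DT_smooth hφ) t) y
        (fun x => ?_) (fun x => ?_) hint
      · have e2 : DT Φ (x, t) = deriv (φ x) t := (DT_slice hφ x t).deriv.symm
        have := heq x t ht0
        rw [e2, this, div_eq_inv_mul]
      · have := hdisc x t ht0
        rw [grad_norm] at this
        rw [div_eq_inv_mul] at this
        rw [div_eq_inv_mul, mul_assoc, ← div_eq_inv_mul, ← div_eq_inv_mul] at *
        simp only [hΦ]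
        linarith)
  have hsig : 0 < sig⁻¹ := by unfold sig; norm_num
  simp_rw [rho_eq, hd1]
  have e3 : ∀ t, ∫ x, RR η (PP d (s - t)) (s - t) y x * (sig⁻¹ * EE ε Φ (x, t)) =
      sig⁻¹ * ∫ x, RR η (PP d (s - t)) (s - t) y x * EE ε Φ (x, t) := fun t => by
    rw [← integral_const_mul]; congr 1; funext x; ring
  have e4 : c * ∫ t in t₁..t₂, Real.exp (-1 / (128 * (s - t))) *
      ∫ x in Metric.ball y (1 / 2), sig⁻¹ * EE ε Φ (x, t) = sig⁻¹ * ∫ t in t₁..t₂,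
      c * (Real.exp (-1 / (128 * (s - t))) * ∫ x in Metric.ball y (1 / 2), EE ε Φ (x, t)) := by
    rw [← intervalIntegral.integral_const_mul, ← intervalIntegral.integral_const_mul]
    congr 1; funext t; rw [integral_const_mul]; ring
  rw [e3, e3, e4, ← mul_add, mul_assoc]
  exact mul_le_mul_of_nonneg_left gr hsig.le
end
end

section
/- Let d ≥ 2 and let μ be a Radon measure on ℝ^d, y ∈ ℝ^d and D > 0 such that μ(B_R(y)) ≤ D ω_{d−1} R^{d−1} for every R > 0. Then there exists c₇ > 0 depending only on d such that for every s > 0: (4πs)^{−(d−1)/2} ∫_{ℝ^d} e^{−|x−y|²/(4s)} dμ(x) ≤ c₇ D. -/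
open MeasureTheory Real Set

noncomputable section

/-- ω_{d-1}: Lebesgue measure of the unit ball in ℝ^{d-1}. -/
def omegaBall (d : ℕ) : ℝ := (volume (Metric.ball (0 : EuclideanSpace ℝ (Fin (d - 1))) 1)).toReal


theorem aux_summable (k : ℕ) : Summable (fun n : ℕ => ((n : ℝ) + 1) ^ k * Real.exp (-(n : ℝ))) := by
  have h := Real.summable_pow_mul_exp_neg_nat_mul k (r := 1) one_pos
  have h2 := ((summable_nat_add_iff 1).2 h).mul_left (Real.exp 1)
  refine h2.congr fun n => ?_
  have : Real.exp (-(n : ℝ)) = Real.exp 1 * Real.exp (-1 * ((n + 1 : ℕ) : ℝ)) := by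
    rw [← Real.exp_add]; congr 1; push_cast; ring
  rw [this]; push_cast; ring

theorem aux_pointwise (t r : ℝ) (hr : 0 < r) (ht : 0 ≤ t) :
    t < (((⌊t / r⌋₊ : ℕ) : ℝ) + 1) * r ∧
      Real.exp (-t ^ 2 / r ^ 2) ≤ Real.exp (-((⌊t / r⌋₊ : ℕ) : ℝ)) := by
  have h1 := Nat.lt_floor_add_one (t / r)
  have h2 := Nat.floor_le (div_nonneg ht hr.le)
  refine ⟨(div_lt_iff₀ hr).1 h1, Real.exp_le_exp.2 ?_⟩
  rw [neg_div, ← div_pow, neg_le_neg_iff]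
  have h3 : ((⌊t / r⌋₊ : ℕ) : ℝ) ≤ ((⌊t / r⌋₊ : ℕ) : ℝ) ^ 2 := by
    exact_mod_cast Nat.le_self_pow two_ne_zero _
  exact h3.trans (pow_le_pow_left₀ (Nat.cast_nonneg _) h2 2)

theorem aux_integral {d : ℕ} (μ : Measure (Ed d)) (y : Ed d) (A r : ℝ) (k : ℕ) (hA : 0 ≤ A)
    (hr : 0 < r)
    (h : ∀ R > (0 : ℝ), μ (Metric.ball y R) ≤ ENNReal.ofReal (A * R ^ k)) :
    ∫ x, Real.exp (-‖x - y‖ ^ 2 / r ^ 2) ∂μ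
      ≤ A * r ^ k * ∑' n : ℕ, ((n : ℝ) + 1) ^ k * Real.exp (-(n : ℝ)) := by
  have hS := aux_summable k
  have hS0 : 0 ≤ ∑' n : ℕ, ((n : ℝ) + 1) ^ k * Real.exp (-(n : ℝ)) :=
    tsum_nonneg fun n => by positivity
  have hB : 0 ≤ A * r ^ k := by positivity
  rw [integral_eq_lintegral_of_nonneg_ae (Filter.Eventually.of_forall fun x => (Real.exp_pos _).le)
    (by
      have hc : Continuous fun x : Ed d => Real.exp (-‖x - y‖ ^ 2 / r ^ 2) := by fun_prop
      exact hc.aestronglyMeasurable)]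
  refine ENNReal.toReal_le_of_le_ofReal (by positivity) ?_
  calc ∫⁻ x, ENNReal.ofReal (Real.exp (-‖x - y‖ ^ 2 / r ^ 2)) ∂μ
      ≤ ∫⁻ x, ∑' n : ℕ, (Metric.ball y (((n : ℝ) + 1) * r)).indicator
          (fun _ => ENNReal.ofReal (Real.exp (-(n : ℝ)))) x ∂μ := by
        refine lintegral_mono fun x => ?_
        obtain ⟨h1, h2⟩ := aux_pointwise ‖x - y‖ r hr (norm_nonneg _)
        refine le_trans ?_ (ENNReal.le_tsum ⌊‖x - y‖ / r⌋₊)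
        rw [indicator_of_mem (by rwa [Metric.mem_ball, dist_eq_norm])]
        exact ENNReal.ofReal_le_ofReal h2
    _ = ∑' n : ℕ, ENNReal.ofReal (Real.exp (-(n : ℝ))) * μ (Metric.ball y (((n : ℝ) + 1) * r)) := by
        rw [lintegral_tsum fun n =>
          (measurable_const.indicator Metric.isOpen_ball.measurableSet).aemeasurable]
        refine tsum_congr fun n => ?_
        rw [lintegral_indicator_const Metric.isOpen_ball.measurableSet]
    _ ≤ ∑' n : ℕ, ENNReal.ofReal (A * r ^ k * (((n : ℝ) + 1) ^ k * Real.exp (-(n : ℝ)))) := by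
        refine ENNReal.tsum_le_tsum fun n => ?_
        refine (mul_le_mul_right (h _ (by positivity)) _).trans ?_
        rw [← ENNReal.ofReal_mul (Real.exp_pos _).le, mul_pow]
        exact le_of_eq (by congr 1; ring)
    _ = ENNReal.ofReal (A * r ^ k * ∑' n : ℕ, ((n : ℝ) + 1) ^ k * Real.exp (-(n : ℝ))) := by
        rw [← ENNReal.ofReal_tsum_of_nonneg (fun n => by positivity) (hS.mul_left _), tsum_mul_left]

/-- Gaussian integral bound from density ratio bounds. -/
theorem gaussian_bound_from_density {d : ℕ} (hd : 2 ≤ d) :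
    ∃ c₇ > (0 : ℝ), ∀ (μ : Measure (Ed d)), IsLocallyFiniteMeasure μ →
      ∀ (y : Ed d) (D : ℝ), 0 < D →
      (∀ R > (0 : ℝ), μ (Metric.ball y R) ≤ ENNReal.ofReal (D * omegaBall d * R ^ (d - 1))) →
      ∀ s > (0 : ℝ),
        (4 * Real.pi * s) ^ (-(((d : ℝ) - 1) / 2)) *
            ∫ x, Real.exp (-‖x - y‖ ^ 2 / (4 * s)) ∂μ
          ≤ c₇ * D := by
  have hω : 0 ≤ omegaBall d := ENNReal.toReal_nonneg
  set S := ∑' n : ℕ, ((n : ℝ) + 1) ^ (d - 1) * Real.exp (-(n : ℝ)) with hSdef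
  have hS0 : 0 ≤ S := tsum_nonneg fun n => by positivity
  set P := Real.pi ^ (-(((d : ℝ) - 1) / 2)) with hP
  have hP0 : 0 < P := Real.rpow_pos_of_pos Real.pi_pos _
  refine ⟨P * omegaBall d * S + 1, by positivity, ?_⟩
  intro μ _ y D hD h s hs
  have h4 : 0 < 4 * s := by positivity
  have hr : 0 < √(4 * s) := Real.sqrt_pos.2 h4
  have key := aux_integral μ y (D * omegaBall d) (√(4 * s)) (d - 1) (by positivity) hr h
  rw [Real.sq_sqrt h4.le, ← hSdef] at key
  have e1 : (4 * Real.pi * s) ^ (-(((d : ℝ) - 1) / 2))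
      = P * (4 * s) ^ (-(((d : ℝ) - 1) / 2)) := by
    rw [hP, ← Real.mul_rpow Real.pi_pos.le h4.le]; congr 1; ring
  have e2 : (4 * s) ^ (-(((d : ℝ) - 1) / 2)) * √(4 * s) ^ (d - 1) = 1 := by
    rw [Real.sqrt_eq_rpow, ← Real.rpow_natCast, ← Real.rpow_mul h4.le, ← Real.rpow_add h4,
      Nat.cast_sub (by omega)]
    convert Real.rpow_zero _ using 2
    push_cast; ring
  rw [e1]
  have hQ : 0 < (4 * s) ^ (-(((d : ℝ) - 1) / 2)) := Real.rpow_pos_of_pos h4 _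
  calc _ ≤ P * (4 * s) ^ (-(((d : ℝ) - 1) / 2)) *
        (D * omegaBall d * √(4 * s) ^ (d - 1) * S) :=
        mul_le_mul_of_nonneg_left key (by positivity)
    _ = P * omegaBall d * S * D * ((4 * s) ^ (-(((d : ℝ) - 1) / 2)) * √(4 * s) ^ (d - 1)) := by ring
    _ = P * omegaBall d * S * D := by rw [e2, mul_one]
    _ ≤ _ := by linarith
end
end

section
/- Let d ≥ 2, ε ∈ (0,1), let λ ∈ ℝ, and let φ : ℝ^d → ℝ and ψ : ℝ^d → ℝ be smooth ℤ^d-periodic functions and ζ = (ζ¹,…,ζ^d) : ℝ^d → ℝ^d a smooth ℤ^d-periodic vector field, such that εψ = εΔφ − W'(φ)/ε + λ√(2W(φ)) on ℝ^d and |φ| ≤ 1. Then ∫_Ω εψ (∇φ·ζ) dx + Σ_{i,j=1}^d ∫_Ω ε (∂_{x_i}φ)(∂_{x_j}φ)(∂_{x_i}ζ^j) dx − ∫_Ω ( ε|∇φ|²/2 + W(φ)/ε ) div ζ dx = −λ ∫_Ω k(φ) div ζ dx. -/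
open MeasureTheory Real Set
open scoped RealInnerProductSpace

noncomputable section

/-- k(s) = ∫₀ˢ √(2W) = s - s³/3. -/
def kk (s : ℝ) : ℝ := s - s ^ 3 / 3

/-- The unit cube Ω = [0,1)^d. -/
def cube (d : ℕ) : Set (Ed d) := {x | ∀ i, x i ∈ Set.Ico (0 : ℝ) 1}

lemma cube_integrableOn {d : ℕ} {f : Ed d → ℝ} (hf : Continuous f) :
    IntegrableOn f (cube d) := by
  have hK : IsCompact ((WithLp.toLp 2) '' (Icc (0 : Fin d → ℝ) 1) : Set (Ed d)) :=
    isCompact_Icc.image (PiLp.continuous_toLp 2 _)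
  refine (hf.continuousOn.integrableOn_compact hK).mono_set ?_
  intro x hx
  refine ⟨WithLp.ofLp x, ⟨fun i => (hx i).1, fun i => (hx i).2.le⟩, rfl⟩

lemma cube_integral_eq {d : ℕ} (f : Ed d → ℝ) :
    ∫ x in cube d, f x = ∫ x in Icc (0 : Fin d → ℝ) 1, f (WithLp.toLp 2 x) := by
  rw [← (PiLp.volume_preserving_toLp (Fin d)).setIntegral_preimage_emb
    (MeasurableEquiv.toLp 2 (Fin d → ℝ)).measurableEmbedding]
  refine setIntegral_congr_set ?_
  have : (WithLp.toLp 2 ⁻¹' cube d : Set (Fin d → ℝ))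
      = Set.pi univ fun i => Ico ((0 : Fin d → ℝ) i) ((1 : Fin d → ℝ) i) := by
    ext x; simp [cube]
  rw [this, volume_pi]
  exact Measure.univ_pi_Ico_ae_eq_Icc

lemma integral_div_zero {d : ℕ} (hd : 2 ≤ d) (F : Fin d → Ed d → ℝ)
    (hF : ∀ i, ContDiff ℝ 1 (F i)) (hper : ∀ i, ZdPeriodic (F i)) :
    ∫ x in cube d, ∑ i, fderiv ℝ (F i) x (ebasis d i) = 0 := by
  obtain ⟨n, rfl⟩ : ∃ n, d = n + 1 := ⟨d - 1, by omega⟩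
  rw [cube_integral_eq]
  let L : (Fin (n+1) → ℝ) →L[ℝ] Ed (n+1) :=
    ((PiLp.continuousLinearEquiv 2 ℝ (fun _ : Fin (n+1) => ℝ)).symm : _ →L[ℝ] _)
  have hL : ∀ x, L x = WithLp.toLp 2 x := fun x => rfl
  have key := integral_divergence_of_hasFDerivAt_off_countable' (0 : Fin (n+1) → ℝ) 1
    (fun i => by simp) (fun i x => F i (L x)) (fun i x => (fderiv ℝ (F i) (L x)).comp L)
    ∅ countable_empty (fun i => ((hF i).continuous.comp L.continuous).continuousOn)
    (fun x _ i => (((hF i).differentiable (by simp)) (L x)).hasFDerivAt.comp x L.hasFDerivAt)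
    (by
      refine ContinuousOn.integrableOn_compact isCompact_Icc ?_
      apply Continuous.continuousOn
      refine continuous_finsetSum _ fun i _ => ?_
      have := (hF i).continuous_fderiv (by simp)
      simp only [ContinuousLinearMap.comp_apply]
      exact (this.comp L.continuous).clm_apply continuous_const)
  simp only [ContinuousLinearMap.comp_apply] at key
  refine Eq.trans ?_ (key.trans ?_)
  · rfl
  · refine Finset.sum_eq_zero fun i _ => ?_
    rw [sub_eq_zero]
    congr 1
    funext x
    have h := hper i (L (i.insertNth 0 x)) (Pi.single i 1)
    simp only [Pi.one_apply, Pi.zero_apply]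
    rw [← h]
    congr 1
    ext j
    refine Fin.succAboveCases i ?_ (fun j => ?_) j
    · simp [hL]
    · simp [hL]

lemma per_fderiv {d : ℕ} {f : Ed d → ℝ} (hf : ZdPeriodic f) (v : Ed d) :
    ZdPeriodic (fun x => fderiv ℝ f x v) := by
  intro x k
  have h : f = fun y => f (y + (WithLp.equiv 2 (Fin d → ℝ)).symm fun i => (k i : ℝ)) := by
    funext y; exact (hf y k).symm
  have := fderiv_comp_add_right (𝕜 := ℝ) (f := f) (x := x)
    ((WithLp.equiv 2 (Fin d → ℝ)).symm fun i => (k i : ℝ))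
  rw [← h] at this
  simp only [this]

lemma fderiv_eb {d : ℕ} (f : Ed d → ℝ) (x v : Ed d) :
    fderiv ℝ f x v = ∑ i, fderiv ℝ f x (ebasis d i) * v i := by
  have h : v = ∑ i, v i • ebasis d i := by
    ext j
    simp [ebasis, Finset.sum_apply, Pi.single_apply]
  conv_lhs => rw [h]
  simp [mul_comm]

lemma inner_grad {d : ℕ} (f : Ed d → ℝ) (x v : Ed d) :
    ⟪gradient f x, v⟫ = ∑ i, fderiv ℝ f x (ebasis d i) * v i := by
  rw [← fderiv_eb, gradient, InnerProductSpace.toDual_symm_apply]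

lemma norm_grad {d : ℕ} (f : Ed d → ℝ) (x : Ed d) :
    ‖gradient f x‖ ^ 2 = ∑ i, fderiv ℝ f x (ebasis d i) ^ 2 := by
  have h : ∀ i, (gradient f x) i = fderiv ℝ f x (ebasis d i) := by
    intro i
    have := inner_grad f x (ebasis d i)
    rw [← fderiv_eb, ebasis, EuclideanSpace.inner_single_right] at this
    simpa [ebasis] using this
  rw [EuclideanSpace.norm_sq_eq]
  simp [h]

/-- Algebra of the pointwise divergence identity. -/
lemma alg_identity {d : ℕ} (ε g w : ℝ) (p z : Fin d → ℝ) (H Z : Fin d → Fin d → ℝ)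
    (hH : ∀ i j, H i j = H j i) :
    ∑ i, ((∑ j, ε * (H i i * p j * z j + p i * H i j * z j + p i * p j * Z i j))
      - ((ε * (∑ j, p j * H i j) - w * p i) * z i + g * Z i i))
    = (ε * (∑ i, H i i) + w) * (∑ j, p j * z j) + (∑ i, ∑ j, ε * p i * p j * Z i j)
      - g * ∑ i, Z i i := by
  have h1 : ∑ i, ∑ j, ε * (p i * H i j * z j) = ∑ i, ε * (∑ j, p j * H i j) * z i := by
    rw [Finset.sum_comm]
    refine Finset.sum_congr rfl fun i _ => ?_
    rw [Finset.mul_sum, Finset.sum_mul]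
    refine Finset.sum_congr rfl fun j _ => ?_
    rw [hH]; ring
  have h2 : ∑ i, ∑ j, ε * (H i i * p j * z j) = ε * (∑ i, H i i) * (∑ j, p j * z j) := by
    rw [mul_assoc, Finset.sum_mul_sum, Finset.mul_sum]
    refine Finset.sum_congr rfl fun i _ => ?_
    rw [Finset.mul_sum]
    refine Finset.sum_congr rfl fun j _ => ?_
    ring
  have h3 : ∑ i, w * p i * z i = w * ∑ j, p j * z j := by
    rw [Finset.mul_sum]
    exact Finset.sum_congr rfl fun j _ => by ring
  have h4 : ∑ i, ∑ j, ε * (p i * p j * Z i j) = ∑ i, ∑ j, ε * p i * p j * Z i j :=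
    Finset.sum_congr rfl fun i _ => Finset.sum_congr rfl fun j _ => by ring
  have h5 : ∑ i, g * Z i i = g * ∑ i, Z i i := by rw [Finset.mul_sum]
  simp only [mul_add, sub_mul, Finset.sum_add_distrib, Finset.sum_sub_distrib, add_mul]
  rw [h1, h2, h3, h4, h5]
  ring

/-- first-variation identity tested with a vector field ζ. -/
theorem first_variation_identity {d : ℕ} (hd : 2 ≤ d) (ε : ℝ) (hε : ε ∈ Set.Ioo (0 : ℝ) 1)
    (lam : ℝ) (φ ψ : Ed d → ℝ) (ζ : Ed d → Ed d)
    (hφ : ContDiff ℝ (⊤ : ℕ∞) φ) (hψ : ContDiff ℝ (⊤ : ℕ∞) ψ) (hζ : ContDiff ℝ (⊤ : ℕ∞) ζ)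
    (hφper : ZdPeriodic φ) (hψper : ZdPeriodic ψ) (hζper : ZdPeriodic ζ)
    (heq : ∀ x : Ed d,
      ε * ψ x = ε * lap φ x - W' (φ x) / ε + lam * Real.sqrt (2 * W (φ x)))
    (hbd : ∀ x, |φ x| ≤ 1) :
    (∫ x in cube d, ε * ψ x * ⟪gradient φ x, ζ x⟫)
        + (∑ i, ∑ j, ∫ x in cube d,
            ε * (fderiv ℝ φ x (ebasis d i)) * (fderiv ℝ φ x (ebasis d j))
              * (fderiv ℝ (fun y => ζ y j) x (ebasis d i)))
        - (∫ x in cube d, (ε * ‖gradient φ x‖ ^ 2 / 2 + W (φ x) / ε)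
            * ∑ i, fderiv ℝ (fun y => ζ y i) x (ebasis d i))
      = -lam * ∫ x in cube d, kk (φ x) * ∑ i, fderiv ℝ (fun y => ζ y i) x (ebasis d i) := by
  let p : Fin d → Ed d → ℝ := fun i x => fderiv ℝ φ x (ebasis d i)
  let z : Fin d → Ed d → ℝ := fun i x => ζ x i
  let g : Ed d → ℝ := fun x =>
    ε * (∑ j, p j x ^ 2) / 2 + W (φ x) / ε - lam * kk (φ x)
  have hφ2 : ContDiff ℝ 2 φ := contDiff_infty.1 hφ 2
  have hφ1 : ContDiff ℝ 1 φ := hφ.of_le (by exact_mod_cast le_top)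
  have hp : ∀ i, ContDiff ℝ 1 (p i) := fun i =>
    (hφ2.fderiv_right (m := 1) (by norm_num)).clm_apply contDiff_const
  have hz : ∀ i, ContDiff ℝ 1 (z i) := fun i =>
    (contDiff_euclidean.1 hζ i).of_le (by exact_mod_cast le_top)
  have hW : ContDiff ℝ 1 (fun x => W (φ x)) := by
    unfold W; fun_prop
  have hk : ContDiff ℝ 1 (fun x => kk (φ x)) := by
    unfold kk; fun_prop
  have hg : ContDiff ℝ 1 g := by
    refine ContDiff.sub (ContDiff.add ?_ (hW.div_const _)) (contDiff_const.mul hk)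
    exact (contDiff_const.mul (ContDiff.sum fun j _ => (hp j).pow 2)).div_const _
  let F : Fin d → Ed d → ℝ := fun i x =>
    (∑ j, ε * (p i x * p j x * z j x)) - g x * z i x
  have hF : ∀ i, ContDiff ℝ 1 (F i) := fun i =>
    (ContDiff.sum fun j _ => contDiff_const.mul (((hp i).mul (hp j)).mul (hz j))).sub
      (hg.mul (hz i))
  have hpper : ∀ i, ZdPeriodic (p i) := fun i => per_fderiv hφper _
  have hFper : ∀ i, ZdPeriodic (F i) := by
    intro i x k
    simp only [F, g, z, hζper x k, hφper x k, fun j => hpper j x k]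
  have h0 := integral_div_zero hd F hF hFper
  have hε0 : ε ≠ 0 := hε.1.ne'
  let H : Fin d → Fin d → Ed d → ℝ := fun i j x => fderiv ℝ (p j) x (ebasis d i)
  let Z : Fin d → Fin d → Ed d → ℝ := fun i j x => fderiv ℝ (z j) x (ebasis d i)
  have hsymm : ∀ x i j, H i j x = H j i x := by
    intro x i j
    have hs := (hφ2.contDiffAt (x := x)).isSymmSndFDerivAt (by simp)
    have hd2 : DifferentiableAt ℝ (fderiv ℝ φ) x :=
      ((hφ2.fderiv_right (m := 1) (by norm_num)).differentiable (by simp)) x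
    have e : ∀ i j, H i j x = fderiv ℝ (fderiv ℝ φ) x (ebasis d i) (ebasis d j) := by
      intro i j
      simp only [H, p]
      rw [fderiv_clm_apply hd2 (differentiableAt_const _)]
      simp
    rw [e, e]; exact hs _ _
  have hdF : ∀ x i, fderiv ℝ (F i) x (ebasis d i) =
      (∑ j, ε * (H i i x * p j x * z j x + p i x * H i j x * z j x + p i x * p j x * Z i j x))
      - ((ε * (∑ j, p j x * H i j x) - (-(W' (φ x) / ε) + lam * (1 - φ x ^ 2)) * p i x) * z i x
        + g x * Z i i x) := by
    intro x i
    have dp : ∀ j, HasFDerivAt (p j) (fderiv ℝ (p j) x) x := fun j =>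
      ((hp j).differentiable (by simp) x).hasFDerivAt
    have dz : ∀ j, HasFDerivAt (z j) (fderiv ℝ (z j) x) x := fun j =>
      ((hz j).differentiable (by simp) x).hasFDerivAt
    have dφ : HasFDerivAt φ (fderiv ℝ φ x) x := (hφ1.differentiable (by simp) x).hasFDerivAt
    have dW : HasFDerivAt (fun x => W (φ x)) (W' (φ x) • fderiv ℝ φ x) x := by
      have : HasDerivAt W (W' (φ x)) (φ x) := by
        have := ((((hasDerivAt_id (φ x)).pow 2).const_sub 1).pow 2).div_const 2
        refine this.congr_deriv ?_
        simp [W']; ring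
      exact this.comp_hasFDerivAt x dφ
    have dk : HasFDerivAt (fun x => kk (φ x)) ((1 - φ x ^ 2) • fderiv ℝ φ x) x := by
      have : HasDerivAt kk (1 - φ x ^ 2) (φ x) := by
        have := (hasDerivAt_id (φ x)).sub (((hasDerivAt_id (φ x)).pow 3).div_const 3)
        refine this.congr_deriv ?_
        simp
      exact this.comp_hasFDerivAt x dφ
    have dg : HasFDerivAt g _ x :=
      ((((HasFDerivAt.fun_sum (u := Finset.univ) fun j _ => (dp j).pow 2).const_mul ε).mul_const
        (1/2)).add (dW.mul_const (1/ε))).sub (dk.const_mul lam) |>.congr_of_eventuallyEq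
        (Filter.Eventually.of_forall fun y => by simp [g]; ring)
    have dF : HasFDerivAt (F i) _ x :=
      (HasFDerivAt.fun_sum (u := Finset.univ) fun j _ =>
        (((dp i).mul (dp j)).mul (dz j)).const_mul ε).sub (dg.mul (dz i))
    rw [dF.fderiv]
    have hpi : fderiv ℝ φ x (ebasis d i) = p i x := rfl
    have hHi : ∀ j, fderiv ℝ (p j) x (ebasis d i) = H i j x := fun _ => rfl
    have hZi : ∀ j, fderiv ℝ (z j) x (ebasis d i) = Z i j x := fun _ => rfl
    simp only [_root_.sub_apply, _root_.add_apply,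
      _root_.sum_apply, _root_.smul_apply, smul_eq_mul, hpi, hHi, hZi,
      Pi.mul_apply]
    have e2 : ∑ j, (2 • p j x ^ (2 - 1)) * H i j x = 2 * ∑ j, p j x * H i j x := by
      rw [Finset.mul_sum]
      refine Finset.sum_congr rfl fun j _ => ?_
      simp; ring
    congr 1
    · refine Finset.sum_congr rfl fun j _ => ?_
      ring
    · rw [e2]; ring
  have hpt : ∀ x, ∑ i, fderiv ℝ (F i) x (ebasis d i) =
      ε * ψ x * (∑ j, p j x * z j x) + (∑ i, ∑ j, ε * p i x * p j x * Z i j x)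
      - (ε * (∑ j, p j x ^ 2) / 2 + W (φ x) / ε) * (∑ i, Z i i x)
      + lam * (kk (φ x) * ∑ i, Z i i x) := by
    intro x
    simp only [hdF]
    rw [alg_identity ε (g x) _ (fun i => p i x) (fun i => z i x) (fun i j => H i j x)
      (fun i j => Z i j x) (hsymm x)]
    have hs : Real.sqrt (2 * W (φ x)) = 1 - φ x ^ 2 := by
      have : 2 * W (φ x) = (1 - φ x ^ 2) ^ 2 := by unfold W; ring
      rw [this, Real.sqrt_sq]
      have := (sq_le_one_iff_abs_le_one (φ x)).2 (hbd x)
      linarith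
    have hl : lap φ x = ∑ i, H i i x := rfl
    rw [heq x, hs, hl]
    simp only [g]
    ring
  have cp := fun i => (hp i).continuous
  have cz := fun i => (hz i).continuous
  have cZ : ∀ i j, Continuous (Z i j) := fun i j =>
    ((hz j).continuous_fderiv (by simp)).clm_apply continuous_const
  have cψ := hψ.continuous
  have cW := hW.continuous
  have ck := hk.continuous
  have iA : IntegrableOn (fun x => ε * ψ x * (∑ j, p j x * z j x)) (cube d) :=
    cube_integrableOn (by fun_prop)
  have iB : ∀ i j, IntegrableOn (fun x => ε * p i x * p j x * Z i j x) (cube d) := fun i j =>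
    cube_integrableOn (by fun_prop)
  have iB' : IntegrableOn (fun x => ∑ i, ∑ j, ε * p i x * p j x * Z i j x) (cube d) :=
    cube_integrableOn (by fun_prop)
  have iC : IntegrableOn (fun x => (ε * (∑ j, p j x ^ 2) / 2 + W (φ x) / ε) * (∑ i, Z i i x))
      (cube d) := cube_integrableOn (by fun_prop)
  have iD : IntegrableOn (fun x => lam * (kk (φ x) * ∑ i, Z i i x)) (cube d) :=
    cube_integrableOn (by fun_prop)
  simp only [hpt] at h0
  have iAB : IntegrableOn (fun x => ε * ψ x * (∑ j, p j x * z j x)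
      + ∑ i, ∑ j, ε * p i x * p j x * Z i j x) (cube d) := iA.add iB'
  have iABC : IntegrableOn (fun x => ε * ψ x * (∑ j, p j x * z j x)
      + (∑ i, ∑ j, ε * p i x * p j x * Z i j x)
      - (ε * (∑ j, p j x ^ 2) / 2 + W (φ x) / ε) * (∑ i, Z i i x)) (cube d) := iAB.sub iC
  rw [integral_add iABC iD, integral_sub iAB iC, integral_add iA iB',
    integral_const_mul, integral_finsetSum _ (fun i _ => integrable_finsetSum _ fun j _ => iB i j)]
    at h0
  simp only [fun i => integral_finsetSum (μ := volume.restrict (cube d)) Finset.univ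
    (fun j _ => iB i j)] at h0
  simp only [inner_grad, norm_grad]
  simp only [p, z, Z] at h0
  linarith
end
end

section
/- Let d ≥ 2, ε ∈ (0,1), T > 0, let λ : [0,∞) → ℝ be continuous, and let φ : ℝ^d × [0,∞) → ℝ be a smooth ℤ^d-periodic (in x) solution of ε∂_tφ = εΔφ − W'(φ)/ε + λ(t)√(2W(φ)). Then for every η ∈ C_c¹(ℝ^d × (0,T)): | ∫₀^T ∫_{ℝ^d} ∂_tη · σ^{−1}( ε|∇φ|²/2 + W(φ)/ε ) dx dt − σ^{−1} ∫₀^T ∫_{ℝ^d} ε (∂_tφ)(∇η·∇φ) dx dt | ≤ σ^{−1} ‖η‖_{C⁰(ℝ^d×(0,T))} ( ∫₀^T ∫_{spt η} ε(Δφ − W'(φ)/ε²)² dx dt )^{1/2} ( ∫₀^T ∫_{spt η} ε(∂_tφ)² dx dt )^{1/2}. -/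
open MeasureTheory Real Set
open scoped RealInnerProductSpace

noncomputable section

lemma grad_apply {d : ℕ} (f : Ed d → ℝ) (x : Ed d) (i : Fin d) :
    gradient f x i = fderiv ℝ f x (ebasis d i) := by
  have h := InnerProductSpace.toDual_symm_apply (𝕜 := ℝ) (x := ebasis d i) (y := fderiv ℝ f x)
  rw [← h, gradient, ebasis, EuclideanSpace.inner_single_right]
  simp

lemma grad_normsq {d : ℕ} (f : Ed d → ℝ) (x : Ed d) :
    ‖gradient f x‖ ^ 2 = ∑ i, (fderiv ℝ f x (ebasis d i)) ^ 2 := by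
  rw [EuclideanSpace.norm_sq_eq]
  simp [grad_apply]

lemma grad_inner {d : ℕ} (f g : Ed d → ℝ) (x : Ed d) :
    ⟪gradient f x, gradient g x⟫ = ∑ i, fderiv ℝ f x (ebasis d i) * fderiv ℝ g x (ebasis d i) := by
  rw [PiLp.inner_apply]
  simp [grad_apply, mul_comm]

lemma fderiv_slice_x {d : ℕ} {u : Ed d × ℝ → ℝ} (hu : Differentiable ℝ u) (x : Ed d) (t : ℝ) (v : Ed d) :
    fderiv ℝ (fun y => u (y, t)) x v = fderiv ℝ u (x, t) (v, 0) := by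
  have h1 : HasFDerivAt (fun y : Ed d => (y, t)) (ContinuousLinearMap.inl ℝ (Ed d) ℝ) x := by
    exact hasFDerivAt_prodMk_left x t
  have h2 := (hu (x, t)).hasFDerivAt.comp x h1
  have h3 : fderiv ℝ (fun y => u (y, t)) x = _ := h2.fderiv
  rw [h3]; simp

lemma deriv_slice_t {d : ℕ} {u : Ed d × ℝ → ℝ} (hu : Differentiable ℝ u) (x : Ed d) (t : ℝ) :
    deriv (fun s => u (x, s)) t = fderiv ℝ u (x, t) (0, 1) := by
  have h1 : HasFDerivAt (fun y : ℝ => (x, y)) (ContinuousLinearMap.inr ℝ (Ed d) ℝ) t := by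
    exact hasFDerivAt_prodMk_right x t
  have h2 := (hu (x, t)).hasFDerivAt.comp t h1
  have h3 : fderiv ℝ (fun y => u (x, y)) t = _ := h2.fderiv
  rw [← fderiv_apply_one_eq_deriv, h3]; simp

lemma int_fderiv_zero {d : ℕ} {F : Ed d × ℝ → ℝ} (hF : ContDiff ℝ 1 F) (hc : HasCompactSupport F)
    (v : Ed d × ℝ) : ∫ p, fderiv ℝ F p v = 0 := by
  have hcont : Continuous (fun p => fderiv ℝ F p v) :=
    (hF.continuous_fderiv one_ne_zero).clm_apply continuous_const
  have hcs : HasCompactSupport (fun p => fderiv ℝ F p v) := hc.fderiv_apply ℝ v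
  have : (volume : Measure (Ed d × ℝ)).IsAddHaarMeasure := by
    rw [Measure.volume_eq_prod]; infer_instance
  have := integral_mul_fderiv_eq_neg_fderiv_mul_of_integrable (μ := (volume : Measure (Ed d × ℝ)))
    (f := fun _ => (1:ℝ)) (g := F) (v := v) (𝕜 := ℝ)
    (by simp) (by simpa using hcont.integrable_of_hasCompactSupport hcs)
    (by simpa using hF.continuous.integrable_of_hasCompactSupport hc) (by fun_prop)
    (fun x _ => hF.differentiable one_ne_zero x)
  simpa using this

lemma slice_int {d : ℕ} {T : ℝ} (hT : 0 < T) {K : Set (Ed d × ℝ)}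
    (hK : K ⊆ Set.univ ×ˢ Set.Ioo 0 T) {f : Ed d × ℝ → ℝ} (hf : Integrable f)
    (h0 : ∀ p, p ∉ K → f p = 0) :
    ∫ t in (0 : ℝ)..T, ∫ x : Ed d, f (x, t) = ∫ p, f p := by
  rw [intervalIntegral.integral_of_le hT.le, setIntegral_eq_integral_of_forall_compl_eq_zero,
    Measure.volume_eq_prod, integral_prod_symm]
  · rwa [← Measure.volume_eq_prod]
  · intro t ht
    rw [integral_eq_zero_of_ae]
    filter_upwards with x
    refine h0 _ fun h => ht ?_
    exact Ioo_subset_Ioc_self (hK h).2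

lemma slice_set_int {d : ℕ} {T : ℝ} (hT : 0 < T) {K : Set (Ed d × ℝ)} (hc : IsCompact K)
    (hK : K ⊆ Set.univ ×ˢ Set.Ioo 0 T) {f : Ed d × ℝ → ℝ} (hf : Continuous f) :
    ∫ t in (0 : ℝ)..T, ∫ x in {x : Ed d | (x, t) ∈ K}, f (x, t) = ∫ p in K, f p := by
  rw [← integral_indicator hc.measurableSet, ← slice_int hT hK]
  · congr 1
    ext t
    have hm : MeasurableSet {x : Ed d | (x, t) ∈ K} :=
      (hc.isClosed.preimage (by fun_prop : Continuous fun x : Ed d => (x, t))).measurableSet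
    rw [← integral_indicator hm]
    rfl
  · exact (integrable_indicator_iff hc.measurableSet).2 (hf.continuousOn.integrableOn_compact hc)
  · intro p hp; simp [hp]

lemma cs_int {d : ℕ} {K : Set (Ed d × ℝ)} (hc : IsCompact K) {f g : Ed d × ℝ → ℝ}
    (hf : Continuous f) (hg : Continuous g) :
    ∫ p in K, |f p| * |g p| ≤ √(∫ p in K, f p ^ 2) * √(∫ p in K, g p ^ 2) := by
  have mem : ∀ {h : Ed d × ℝ → ℝ}, Continuous h →
      MemLp h (ENNReal.ofReal 2) (volume.restrict K) := by
    intro h hh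
    have : ENNReal.ofReal 2 = 2 := by simp
    rw [this, memLp_two_iff_integrable_sq hh.aestronglyMeasurable]
    exact (by fun_prop : Continuous fun x => h x ^ 2).continuousOn.integrableOn_compact hc
  have := integral_mul_norm_le_Lp_mul_Lq (μ := volume.restrict K) Real.HolderConjugate.two_two
    (mem hf) (mem hg)
  simpa [Real.sqrt_eq_rpow] using this

lemma main_bound {d : ℕ} {ε : ℝ} (hε : 0 < ε) {η a b : Ed d × ℝ → ℝ} (hη : Continuous η)
    (hc : HasCompactSupport η) (ha : Continuous a) (hb : Continuous b) :
    |∫ p, η p * (ε * b p * a p)| ≤ (⨆ p, |η p|) * √(∫ p in tsupport η, ε * a p ^ 2) *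
      √(∫ p in tsupport η, ε * b p ^ 2) := by
  have hbd : BddAbove (range fun p => |η p|) := by
    obtain ⟨C, hC⟩ := hc.exists_bound_of_continuous hη
    exact ⟨C, by rintro _ ⟨p, rfl⟩; exact hC p⟩
  have hK : IsCompact (tsupport η) := hc
  have e1 : ∫ p, η p * (ε * b p * a p) = ∫ p in tsupport η, η p * (ε * b p * a p) := by
    rw [setIntegral_eq_integral_of_forall_compl_eq_zero]
    intro p hp
    simp [image_eq_zero_of_notMem_tsupport hp]
  have hs := Real.mul_self_sqrt hε.le
  have e2 := cs_int hK (f := fun p => √ε * a p) (g := fun p => √ε * b p) (by fun_prop) (by fun_prop)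
  simp only [mul_pow, Real.sq_sqrt hε.le] at e2
  rw [e1, mul_assoc]
  calc _ ≤ ∫ p in tsupport η, |η p * (ε * b p * a p)| := abs_integral_le_integral_abs
    _ ≤ ∫ p in tsupport η, (⨆ p, |η p|) * (|√ε * a p| * |√ε * b p|) := by
        apply setIntegral_mono
        · exact (by fun_prop : Continuous fun p => |η p * (ε * b p * a p)|).continuousOn.integrableOn_compact hK
        · exact (by fun_prop : Continuous fun p => (⨆ p, |η p|) * (|√ε * a p| * |√ε * b p|)).continuousOn.integrableOn_compact hK
        · intro p
          have : |√ε * a p| * |√ε * b p| = |ε * b p * a p| := by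
            rw [← abs_mul]; congr 1; linear_combination (a p * b p) * hs
          simp only [this]
          rw [abs_mul]
          exact mul_le_mul_of_nonneg_right (le_ciSup hbd p) (abs_nonneg _)
    _ = (⨆ p, |η p|) * ∫ p in tsupport η, (|√ε * a p| * |√ε * b p|) := integral_const_mul _ _
    _ ≤ _ := mul_le_mul_of_nonneg_left e2 (Real.iSup_nonneg fun _ => abs_nonneg _)

lemma contDiff_dir {d : ℕ} {u : Ed d × ℝ → ℝ} (hu : ContDiff ℝ (⊤ : ℕ∞) u) (v : Ed d × ℝ) :
    ContDiff ℝ (⊤ : ℕ∞) (fun p => fderiv ℝ u p v) :=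
  (hu.fderiv_right (m := (⊤ : ℕ∞)) (by simp)).clm_apply contDiff_const

lemma mixed {d : ℕ} {u : Ed d × ℝ → ℝ} (hu : ContDiff ℝ (⊤ : ℕ∞) u) (v w p : Ed d × ℝ) :
    fderiv ℝ (fun q => fderiv ℝ u q v) p w = fderiv ℝ (fun q => fderiv ℝ u q w) p v := by
  have hs : IsSymmSndFDerivAt ℝ u p := hu.contDiffAt.isSymmSndFDerivAt (by simp only [minSmoothness_of_isRCLikeNormedField]; exact WithTop.coe_le_coe.2 le_top)
  have hd : DifferentiableAt ℝ (fderiv ℝ u) p :=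
    (hu.fderiv_right (m := (⊤ : ℕ∞)) (by simp)).differentiable (by simp) p
  have key : ∀ v w, fderiv ℝ (fun q => fderiv ℝ u q v) p w = fderiv ℝ (fderiv ℝ u) p w v := by
    intro v w
    rw [fderiv_clm_apply hd (by fun_prop)]
    simp
  rw [key, key, hs.eq]

lemma lap_slice {d : ℕ} {u : Ed d × ℝ → ℝ} (hu : ContDiff ℝ (⊤ : ℕ∞) u) (x : Ed d) (t : ℝ) :
    lap (fun y => u (y, t)) x =
      ∑ i, fderiv ℝ (fun q => fderiv ℝ u q (ebasis d i, 0)) (x, t) (ebasis d i, 0) := by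
  unfold lap
  refine Finset.sum_congr rfl fun i _ => ?_
  have : (fun y => fderiv ℝ (fun y => u (y, t)) y (ebasis d i)) =
      fun y => fderiv ℝ u (y, t) (ebasis d i, 0) := by
    ext y; exact fderiv_slice_x (hu.differentiable (by simp)) y t _
  rw [this]
  exact fderiv_slice_x (u := fun q => fderiv ℝ u q (ebasis d i, 0))
    ((contDiff_dir hu _).differentiable (by simp)) x t _

lemma identity {d : ℕ} {ε : ℝ} (hε : 0 < ε) {u η : Ed d × ℝ → ℝ} (hu : ContDiff ℝ (⊤ : ℕ∞) u)
    (hη : ContDiff ℝ 1 η) (p : Ed d × ℝ) :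
    fderiv ℝ η p (0, 1) * (sig⁻¹ * (ε * (∑ i, (fderiv ℝ u p (ebasis d i, 0)) ^ 2) / 2 + W (u p) / ε))
      - sig⁻¹ * (ε * fderiv ℝ u p (0, 1) *
        ∑ i, fderiv ℝ η p (ebasis d i, 0) * fderiv ℝ u p (ebasis d i, 0))
      - sig⁻¹ * (η p * (ε * fderiv ℝ u p (0, 1) *
        ((∑ i, fderiv ℝ (fun q => fderiv ℝ u q (ebasis d i, 0)) p (ebasis d i, 0))
          - W' (u p) / ε ^ 2)))
    = fderiv ℝ (fun p => η p * (sig⁻¹ * (ε * (∑ i, (fderiv ℝ u p (ebasis d i, 0)) ^ 2) / 2 + W (u p) / ε))) p (0, 1)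
      - ∑ i, sig⁻¹ * ε * fderiv ℝ (fun p => η p * (fderiv ℝ u p (0, 1) * fderiv ℝ u p (ebasis d i, 0))) p (ebasis d i, 0) := by
  have hη' := (hη.differentiable one_ne_zero p).hasFDerivAt
  have hu' := (hu.differentiable (by simp) p).hasFDerivAt
  have hv : ∀ v, HasFDerivAt (fun q => fderiv ℝ u q v) (fderiv ℝ (fun q => fderiv ℝ u q v) p) p :=
    fun v => ((contDiff_dir hu v).differentiable (by simp) p).hasFDerivAt
  have hW : HasFDerivAt (fun p => W (u p)) (W' (u p) • fderiv ℝ u p) p := by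
    have : HasDerivAt W (W' (u p)) (u p) := by
      unfold W W'
      have := ((((hasDerivAt_id (u p)).pow 2).const_sub 1).pow 2).div_const 2
      refine this.congr_deriv ?_
      simp; ring
    exact this.comp_hasFDerivAt p hu'
  have h1 := hη'.mul ((((HasFDerivAt.fun_sum (u := Finset.univ) fun i _ => (hv (ebasis d i, 0)).pow 2).const_mul ε).mul_const 2⁻¹).add (hW.mul_const ε⁻¹) |>.const_mul sig⁻¹)
  have h2 := fun i => hη'.mul ((hv (0, 1)).mul (hv (ebasis d i, 0)))
  have e1 : fderiv ℝ (fun p => η p * (sig⁻¹ * (ε * (∑ i, (fderiv ℝ u p (ebasis d i, 0)) ^ 2) / 2 + W (u p) / ε))) p (0, 1)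
      = fderiv ℝ η p (0, 1) * (sig⁻¹ * (ε * (∑ i, (fderiv ℝ u p (ebasis d i, 0)) ^ 2) / 2 + W (u p) / ε))
        + η p * (sig⁻¹ * (ε * (∑ i, fderiv ℝ u p (ebasis d i, 0) *
            fderiv ℝ (fun q => fderiv ℝ u q (0, 1)) p (ebasis d i, 0))
            + W' (u p) * fderiv ℝ u p (0, 1) / ε)) := by
    have := DFunLike.congr_fun h1.fderiv ((0, 1) : Ed d × ℝ)
    simp only [div_eq_mul_inv]
    refine Eq.trans this ?_
    simp only [_root_.add_apply, _root_.smul_apply,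
      _root_.sum_apply, smul_eq_mul, Pi.mul_apply, Pi.add_apply, mixed hu (0, 1)]
    have : ∀ f g : Fin d → ℝ, ∑ i, (2 • f i ^ (2 - 1)) * g i = 2 * ∑ i, f i * g i := by
      intro f g; rw [Finset.mul_sum]; refine Finset.sum_congr rfl fun i _ => ?_
      simp; ring
    rw [this]
    ring
  have e2 : ∀ i, fderiv ℝ (fun p => η p * (fderiv ℝ u p (0, 1) * fderiv ℝ u p (ebasis d i, 0))) p (ebasis d i, 0)
      = fderiv ℝ u p (0, 1) * (fderiv ℝ η p (ebasis d i, 0) * fderiv ℝ u p (ebasis d i, 0))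
       + η p * (fderiv ℝ u p (ebasis d i, 0) *
            fderiv ℝ (fun q => fderiv ℝ u q (0, 1)) p (ebasis d i, 0))
       + η p * fderiv ℝ u p (0, 1) *
          fderiv ℝ (fun q => fderiv ℝ u q (ebasis d i, 0)) p (ebasis d i, 0) := by
    intro i
    refine (DFunLike.congr_fun (h2 i).fderiv ((ebasis d i, 0) : Ed d × ℝ)).trans ?_
    simp only [_root_.add_apply, _root_.smul_apply, smul_eq_mul, Pi.mul_apply, Pi.add_apply]
    ring
  rw [e1, ← Finset.mul_sum]
  simp only [e2, Finset.sum_add_distrib, ← Finset.mul_sum]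
  field_simp
  ring

/-- the key Brakke-type estimate for test functions. -/
theorem brakke_type_estimate {d : ℕ} (hd : 2 ≤ d) (ε : ℝ) (hε : ε ∈ Set.Ioo (0 : ℝ) 1)
    (T : ℝ) (hT : 0 < T)
    (lam : ℝ → ℝ) (hlam : ContinuousOn lam (Set.Ici 0))
    (φ : Ed d → ℝ → ℝ)
    (hφ : ContDiff ℝ (⊤ : ℕ∞) (fun p : Ed d × ℝ => φ p.1 p.2))
    (hper : ∀ t, ZdPeriodic fun x => φ x t)
    (hpde : ∀ (x : Ed d) (t : ℝ), 0 ≤ t →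
      ε * deriv (φ x) t =
        ε * lap (fun y => φ y t) x - W' (φ x t) / ε + lam t * Real.sqrt (2 * W (φ x t))) :
    ∀ η : Ed d × ℝ → ℝ, ContDiff ℝ 1 η → HasCompactSupport η →
      tsupport η ⊆ Set.univ ×ˢ Set.Ioo 0 T →
      |(∫ t in (0 : ℝ)..T, ∫ x : Ed d,
            deriv (fun τ => η (x, τ)) t
              * (sig⁻¹ * (ε * ‖gradient (fun y => φ y t) x‖ ^ 2 / 2 + W (φ x t) / ε)))
          - sig⁻¹ * ∫ t in (0 : ℝ)..T, ∫ x : Ed d,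
              ε * deriv (φ x) t
                * ⟪gradient (fun z => η (z, t)) x, gradient (fun z => φ z t) x⟫|
        ≤ sig⁻¹ * (⨆ p : Ed d × ℝ, |η p|)
            * Real.sqrt (∫ t in (0 : ℝ)..T, ∫ x in {x : Ed d | (x, t) ∈ tsupport η},
                ε * (lap (fun y => φ y t) x - W' (φ x t) / ε ^ 2) ^ 2)
            * Real.sqrt (∫ t in (0 : ℝ)..T, ∫ x in {x : Ed d | (x, t) ∈ tsupport η},
                ε * (deriv (φ x) t) ^ 2) := by
  intro η hη hc hK
  have hε0 : 0 < ε := hε.1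
  set u : Ed d × ℝ → ℝ := fun p => φ p.1 p.2 with hu_def
  have hud : Differentiable ℝ u := hφ.differentiable (by simp)
  have hηd : Differentiable ℝ η := hη.differentiable one_ne_zero
  -- the functions on space-time
  let E : Ed d × ℝ → ℝ := fun p =>
    sig⁻¹ * (ε * (∑ i, (fderiv ℝ u p (ebasis d i, 0)) ^ 2) / 2 + W (u p) / ε)
  let ut : Ed d × ℝ → ℝ := fun p => fderiv ℝ u p (0, 1)
  let a : Ed d × ℝ → ℝ := fun p =>
    (∑ i, fderiv ℝ (fun q => fderiv ℝ u q (ebasis d i, 0)) p (ebasis d i, 0)) - W' (u p) / ε ^ 2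
  let A : Ed d × ℝ → ℝ := fun p => fderiv ℝ η p (0, 1) * E p
  let B : Ed d × ℝ → ℝ := fun p => ε * ut p *
    ∑ i, fderiv ℝ η p (ebasis d i, 0) * fderiv ℝ u p (ebasis d i, 0)
  let F : Ed d × ℝ → ℝ := fun p => η p * E p
  let G : Fin d → Ed d × ℝ → ℝ := fun i p => η p * (ut p * fderiv ℝ u p (ebasis d i, 0))
  have hdir := fun v => contDiff_dir hφ v
  have hdir1 : ∀ v, ContDiff ℝ 1 (fun p => fderiv ℝ u p v) := fun v => (hdir v).of_le (by simp)
  have hu1 : ContDiff ℝ 1 u := hφ.of_le (by simp)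
  have hE : ContDiff ℝ 1 E := by
    have : ContDiff ℝ 1 (fun p => ∑ i, (fderiv ℝ u p (ebasis d i, 0)) ^ 2) :=
      ContDiff.sum fun i _ => (hdir1 _).pow 2
    simp only [E, W]
    fun_prop
  have hut : Continuous ut := (hdir1 _).continuous
  have ha : Continuous a := by
    have h1 : Continuous (fun p => ∑ i, fderiv ℝ (fun q => fderiv ℝ u q (ebasis d i, 0)) p (ebasis d i, 0)) :=
      continuous_finsetSum _ fun i _ => (contDiff_dir (hdir _) _).continuous
    have h2 := hu1.continuous
    simp only [a, W']
    fun_prop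
  have hηv : ∀ v, Continuous (fun p => fderiv ℝ η p v) := fun v =>
    (hη.continuous_fderiv one_ne_zero).clm_apply continuous_const
  have hη0 : ∀ p, p ∉ tsupport η → ∀ v, fderiv ℝ η p v = 0 := by
    intro p hp v
    rw [fderiv_of_notMem_tsupport ℝ hp]; simp
  have hA : Continuous A := (hηv _).mul hE.continuous
  have hB : Continuous B := (continuous_const.mul hut).mul
    (continuous_finsetSum _ fun i _ => (hηv _).mul (hdir1 _).continuous)
  have hA0 : ∀ p, p ∉ tsupport η → A p = 0 := fun p hp => by simp [A, hη0 p hp]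
  have hB0 : ∀ p, p ∉ tsupport η → B p = 0 := fun p hp => by simp [B, hη0 p hp]
  have hAi : Integrable A :=
    hA.integrable_of_hasCompactSupport (HasCompactSupport.intro hc hA0)
  have hBi : Integrable B :=
    hB.integrable_of_hasCompactSupport (HasCompactSupport.intro hc hB0)
  have hF : ContDiff ℝ 1 F := hη.mul hE
  have hG : ∀ i, ContDiff ℝ 1 (G i) := fun i => hη.mul ((hdir1 _).mul (hdir1 _))
  have hFc : HasCompactSupport F := hc.mul_right
  have hGc : ∀ i, HasCompactSupport (G i) := fun i => hc.mul_right
  have hCi : Integrable (fun p => η p * (ε * ut p * a p)) := by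
    have hη' := hη.continuous
    exact (by fun_prop : Continuous fun p => η p * (ε * ut p * a p)).integrable_of_hasCompactSupport
      hc.mul_right
  have hint : ∀ {H : Ed d × ℝ → ℝ}, ContDiff ℝ 1 H → HasCompactSupport H → ∀ v,
      Integrable (fun p => fderiv ℝ H p v) := fun hH hHc v =>
    ((hH.continuous_fderiv one_ne_zero).clm_apply continuous_const).integrable_of_hasCompactSupport
      (hHc.fderiv_apply ℝ v)
  have key : (∫ p, A p) - sig⁻¹ * (∫ p, B p) = sig⁻¹ * ∫ p, η p * (ε * ut p * a p) := by
    have hABi : Integrable (fun p => A p - sig⁻¹ * B p) := hAi.sub (hBi.const_mul _)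
    rw [← sub_eq_zero, ← integral_const_mul, ← integral_const_mul,
      ← integral_sub hAi (hBi.const_mul _), ← integral_sub hABi (hCi.const_mul _)]
    have : ∀ p, A p - sig⁻¹ * B p - sig⁻¹ * (η p * (ε * ut p * a p)) =
        fderiv ℝ F p (0, 1) - ∑ i, sig⁻¹ * ε * fderiv ℝ (G i) p (ebasis d i, 0) :=
      fun p => identity hε0 hφ hη p
    simp only [this]
    rw [integral_sub (hint hF hFc _)
      (integrable_finset_sum _ fun i _ => (hint (hG i) (hGc i) _).const_mul _),
      integral_finset_sum _ fun i _ => (hint (hG i) (hGc i) _).const_mul _,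
      int_fderiv_zero hF hFc]
    simp [integral_const_mul, int_fderiv_zero (hG _) (hGc _)]
  have hdt : ∀ x t, deriv (φ x) t = ut (x, t) := fun x t => deriv_slice_t hud x t
  have hgx : ∀ x t v, fderiv ℝ (fun y => φ y t) x v = fderiv ℝ u (x, t) (v, 0) :=
    fun x t v => fderiv_slice_x hud x t v
  have hlap : ∀ x t, lap (fun y => φ y t) x - W' (φ x t) / ε ^ 2 = a (x, t) := fun x t => by
    have : lap (fun y => φ y t) x = _ := lap_slice hφ x t
    rw [this]
  have I1 : (∫ t in (0 : ℝ)..T, ∫ x : Ed d, deriv (fun τ => η (x, τ)) t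
      * (sig⁻¹ * (ε * ‖gradient (fun y => φ y t) x‖ ^ 2 / 2 + W (φ x t) / ε))) = ∫ p, A p := by
    rw [← slice_int hT hK hAi hA0]
    simp only [deriv_slice_t hηd, grad_normsq, hgx, A, E, u]
  have I2 : (∫ t in (0 : ℝ)..T, ∫ x : Ed d, ε * deriv (φ x) t
      * ⟪gradient (fun z => η (z, t)) x, gradient (fun z => φ z t) x⟫) = ∫ p, B p := by
    rw [← slice_int hT hK hBi hB0]
    simp only [grad_inner, fderiv_slice_x hηd, hgx, hdt, B]
  rw [I1, I2, key]
  simp only [hlap, hdt]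
  rw [slice_set_int hT hc hK (f := fun p => ε * a p ^ 2) (by fun_prop),
    slice_set_int hT hc hK (f := fun p => ε * ut p ^ 2) (by fun_prop), abs_mul,
    abs_of_nonneg (by norm_num [sig] : (0 : ℝ) ≤ sig⁻¹), mul_assoc sig⁻¹, mul_assoc sig⁻¹]
  exact mul_le_mul_of_nonneg_left (main_bound hε0 hη.continuous hc ha hut) (by norm_num [sig])
end
end
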